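/- Let k be a field of characteristic p > 0. Then every finite subgroup of PGL₂(k) is isomorphic to one of the following groups: a cyclic group ℤ/nℤ with p ∤ n; a dihedral group D_n of order 2n with p ∤ n; the alternating group A₄; the symmetric group S₄; the alternating group A₅; a semidirect product E ⋊ C, where E is an elementary abelian p-group of order p^t, C is a cyclic group of order n dividing p^t − 1, and every nontrivial element of C acts on E without nontrivial fixed points; PSL₂(F_{p^t}) for some t ≥ 1; or PGL₂(F_{p^t}) for some t ≥ 1. -/

import Mathlib

/-- `PGL₂(k)`: the quotient of `GL₂(k)` by its center (the nonzero scalar matrices). -/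
abbrev PGL2 (k : Type) [Field k] : Type :=
  GL (Fin 2) k ⧸ Subgroup.center (GL (Fin 2) k)

/-- `PSL₂(k)`: the quotient of `SL₂(k)` by its center. -/
abbrev PSL2 (k : Type) [Field k] : Type :=
  Matrix.SpecialLinearGroup (Fin 2) k ⧸ Subgroup.center (Matrix.SpecialLinearGroup (Fin 2) k)

namespace Dick

open OnePoint

section basic

variable {K : Type} [Field K]

lemma center_iff (A : GL (Fin 2) K) :
    A ∈ Subgroup.center (GL (Fin 2) K) ↔ A 0 1 = 0 ∧ A 1 0 = 0 ∧ A 0 0 = A 1 1 := by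
  rw [Matrix.GeneralLinearGroup.mem_center_iff_val_mem_range_scalar]
  constructor
  · rintro ⟨a, ha⟩
    simp [← ha]
  · rintro ⟨h1, h2, h3⟩
    refine ⟨A 0 0, ?_⟩
    ext i j
    fin_cases i <;> fin_cases j <;> simp [h1, h2, h3]

noncomputable instance actX : MulAction (PGL2 K) (OnePoint K) := by
  classical
  refine Matrix.ProjGenLinGroup.mulActionOfGL (n := Fin 2) (R := K) (α := OnePoint K) ?_
  intro u x
  induction x using OnePoint.rec with
  | infty => simp [OnePoint.smul_infty_eq_ite]
  | coe z => simp [OnePoint.smul_some_eq_ite]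

open Classical in
lemma mk_smul (A : GL (Fin 2) K) (x : OnePoint K) : (A : PGL2 K) • x = A • x := rfl

lemma smul_inf0 (A : GL (Fin 2) K) (h : A 1 0 = 0) : (A : PGL2 K) • (∞ : OnePoint K) = ∞ := by
  classical
  rw [mk_smul, OnePoint.smul_infty_eq_ite, if_pos h]

lemma smul_inf1 (A : GL (Fin 2) K) (h : A 1 0 ≠ 0) :
    (A : PGL2 K) • (∞ : OnePoint K) = ((A 0 0 / A 1 0 : K) : OnePoint K) := by
  classical
  rw [mk_smul, OnePoint.smul_infty_eq_ite, if_neg h]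

lemma smul_coe0 (A : GL (Fin 2) K) (z : K) (h : A 1 0 * z + A 1 1 = 0) :
    (A : PGL2 K) • (z : OnePoint K) = ∞ := by
  classical
  rw [mk_smul, OnePoint.smul_some_eq_ite, if_pos h]

lemma smul_coe1 (A : GL (Fin 2) K) (z : K) (h : A 1 0 * z + A 1 1 ≠ 0) :
    (A : PGL2 K) • (z : OnePoint K) =
      (((A 0 0 * z + A 0 1) / (A 1 0 * z + A 1 1) : K) : OnePoint K) := by
  classical
  rw [mk_smul, OnePoint.smul_some_eq_ite, if_neg h]

/-- The matrix `[a b; c d]`. -/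
noncomputable def mt (a b c d : K) (h : a * d - b * c ≠ 0) : GL (Fin 2) K :=
  Matrix.GeneralLinearGroup.mkOfDetNeZero !![a, b; c, d] (by rwa [Matrix.det_fin_two_of])

section
variable (a b c d : K) (h : a * d - b * c ≠ 0)
@[simp] lemma mt00 : mt a b c d h 0 0 = a := rfl
@[simp] lemma mt01 : mt a b c d h 0 1 = b := rfl
@[simp] lemma mt10 : mt a b c d h 1 0 = c := rfl
@[simp] lemma mt11 : mt a b c d h 1 1 = d := rfl
end

lemma det_ne (A : GL (Fin 2) K) : A 0 0 * A 1 1 - A 0 1 * A 1 0 ≠ 0 := by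
  have := A.det_ne_zero
  rwa [Matrix.det_fin_two] at this

lemma gl_ext (A B : GL (Fin 2) K) (h0 : A 0 0 = B 0 0) (h1 : A 0 1 = B 0 1) (h2 : A 1 0 = B 1 0)
    (h3 : A 1 1 = B 1 1) : A = B := by
  ext i j
  fin_cases i <;> fin_cases j <;> assumption

lemma mk_eq (A B : GL (Fin 2) K) (r : K) (hr : r ≠ 0) (h0 : A 0 0 = r * B 0 0)
    (h1 : A 0 1 = r * B 0 1) (h2 : A 1 0 = r * B 1 0)
    (h3 : A 1 1 = r * B 1 1) : (A : PGL2 K) = B := by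
  symm
  rw [QuotientGroup.eq]
  have : A = B * mt r 0 0 r (by simpa using hr) := by
    apply gl_ext <;> simp [Matrix.mul_apply, *, mul_comm]
  rw [this, inv_mul_cancel_left, center_iff]
  simp

/-- affine map `z ↦ a z + b` -/
noncomputable def aff (a : Kˣ) (b : K) : PGL2 K := (mt (a : K) b 0 1 (by simp) : GL (Fin 2) K)

@[simp] lemma aff_inf (a : Kˣ) (b : K) : aff a b • (∞ : OnePoint K) = ∞ :=
  smul_inf0 _ (by simp)

@[simp] lemma aff_coe (a : Kˣ) (b z : K) : aff a b • (z : OnePoint K) = ((a * z + b : K) : OnePoint K) := by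
  rw [aff, smul_coe1 _ _ (by simp)]; simp

lemma aff_mul (a a' : Kˣ) (b b' : K) : aff a b * aff a' b' = aff (a * a') (a * b' + b) := by
  rw [aff, aff, aff, ← QuotientGroup.mk_mul]
  refine mk_eq _ _ 1 one_ne_zero ?_ ?_ ?_ ?_ <;> simp [Matrix.mul_apply]

lemma aff_one : aff (1 : Kˣ) (0 : K) = 1 := by
  rw [aff, ← QuotientGroup.mk_one]
  refine mk_eq _ _ 1 one_ne_zero ?_ ?_ ?_ ?_ <;> simp

lemma aff_inj {a a' : Kˣ} {b b' : K} : aff a b = aff a' b' ↔ a = a' ∧ b = b' := by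
  constructor
  · intro h
    have h0 := congrArg (fun g : PGL2 K => g • ((0 : K) : OnePoint K)) h
    have h1 := congrArg (fun g : PGL2 K => g • ((1 : K) : OnePoint K)) h
    simp only [aff_coe, OnePoint.coe_eq_coe] at h0 h1
    have hb : b = b' := by simpa using h0
    refine ⟨Units.ext ?_, hb⟩
    simpa [hb] using h1
  · rintro ⟨rfl, rfl⟩; rfl

lemma aff_inv (a : Kˣ) (b : K) : (aff a b)⁻¹ = aff a⁻¹ (-(a⁻¹ : Kˣ) * b) := by
  rw [inv_eq_iff_mul_eq_one, aff_mul, ← aff_one, aff_inj]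
  simp

lemma aff_pow (a : Kˣ) (n : ℕ) : (aff a 0) ^ n = aff (a ^ n) 0 := by
  induction n with
  | zero => simp [aff_one]
  | succ n ih => rw [pow_succ, ih, aff_mul, pow_succ]; simp

lemma trans_pow (b : K) (n : ℕ) : (aff 1 b) ^ n = aff 1 (n * b) := by
  induction n with
  | zero => simp [aff_one]
  | succ n ih => rw [pow_succ, ih, aff_mul]; congr 1 <;> simp; ring

lemma exists_aff {g : PGL2 K} (h : g • (∞ : OnePoint K) = ∞) : ∃ a b, g = aff a b := by
  induction g using QuotientGroup.induction_on with | H A =>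
  have h10 : A 1 0 = 0 := by
    by_contra hc
    rw [smul_inf1 _ hc] at h
    simp at h
  have hd := det_ne A
  rw [h10, mul_zero, sub_zero] at hd
  have h00 := left_ne_zero_of_mul hd
  have h11 := right_ne_zero_of_mul hd
  refine ⟨Units.mk0 (A 0 0 / A 1 1) (div_ne_zero h00 h11), A 0 1 / A 1 1, ?_⟩
  rw [aff]
  refine mk_eq _ _ (A 1 1) h11 ?_ ?_ ?_ ?_ <;> simp [h10] <;> field_simp

/-- moves `x` to `∞` and `y` to `0`. -/
lemma exists_move (x y : OnePoint K) (hxy : x ≠ y) :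
    ∃ b : PGL2 K, b • x = ∞ ∧ b • y = ((0 : K) : OnePoint K) := by
  have key : ∃ b : PGL2 K, b • x = ∞ := by
    induction x using OnePoint.rec with
    | infty => exact ⟨1, one_smul _ _⟩
    | coe z => exact ⟨(mt 0 1 1 (-z) (by simp) : GL (Fin 2) K), smul_coe0 _ _ (by simp)⟩
  obtain ⟨b, hb⟩ := key
  have hy : b • y ≠ ∞ := by
    rw [← hb]; intro h; exact hxy (MulAction.injective b h).symm
  obtain ⟨w, hw⟩ := OnePoint.ne_infty_iff_exists.mp hy
  refine ⟨aff 1 (-w) * b, ?_, ?_⟩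
  · rw [mul_smul, hb, aff_inf]
  · rw [mul_smul, ← hw, aff_coe]; simp

/-- elements swapping `0` and `∞` are involutions -/
lemma swap_sq0 {g : PGL2 K} (h : g • (∞ : OnePoint K) = ((0 : K) : OnePoint K))
    (h' : g • ((0 : K) : OnePoint K) = ∞) : g * g = 1 := by
  induction g using QuotientGroup.induction_on with | H A =>
  have h10 : A 1 0 ≠ 0 := by
    intro hc
    rw [smul_inf0 _ hc] at h
    simp at h
  have h11 : A 1 1 = 0 := by
    by_contra hc
    rw [smul_coe1 _ _ (by simpa using hc)] at h'
    simp at h'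
  rw [smul_inf1 _ h10, OnePoint.coe_eq_coe] at h
  have h00 : A 0 0 = 0 := by simpa [h10] using h
  have hd := det_ne A
  rw [← QuotientGroup.mk_mul, ← QuotientGroup.mk_one]
  refine mk_eq _ _ (A 0 1 * A 1 0) (by intro h; simp [h, h00] at hd) ?_ ?_ ?_ ?_ <;>
    simp [Matrix.mul_apply, Fin.sum_univ_two, h00, h11, mul_comm]

lemma conj_fix (b g : PGL2 K) (x : OnePoint K) :
    (b * g * b⁻¹) • (b • x) = b • x ↔ g • x = x := by
  rw [mul_smul, inv_smul_smul, mul_smul]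
  exact (MulAction.injective b).eq_iff

lemma conj_smul (b g : PGL2 K) (x : OnePoint K) :
    (b * g * b⁻¹) • (b • x) = b • (g • x) := by
  rw [mul_smul, inv_smul_smul, mul_smul]

lemma swap_sq {g : PGL2 K} {x y : OnePoint K} (hxy : x ≠ y) (h : g • x = y) (h' : g • y = x) :
    g * g = 1 := by
  obtain ⟨b, hb1, hb2⟩ := exists_move x y hxy
  have := swap_sq0 (g := b * g * b⁻¹) (by rw [← hb1, conj_smul, h, hb2])
    (by rw [← hb2, conj_smul, h', hb1])
  have h2 : b * (g * g) * b⁻¹ = 1 := by rw [← this]; group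
  rwa [conj_eq_one_iff] at h2

lemma fix3 {g : PGL2 K} {x y z : OnePoint K} (hxy : x ≠ y) (hxz : x ≠ z) (hyz : y ≠ z)
    (hx : g • x = x) (hy : g • y = y) (hz : g • z = z) : g = 1 := by
  obtain ⟨b, hb1, hb2⟩ := exists_move x y hxy
  have h1 := (conj_fix b g x).2 hx
  have h2 := (conj_fix b g y).2 hy
  have h3 := (conj_fix b g z).2 hz
  rw [hb1] at h1
  rw [hb2] at h2
  obtain ⟨a, c, hac⟩ := exists_aff h1
  have hz' : b • z ≠ ∞ := by
    rw [← hb1]; intro h; exact hxz (MulAction.injective b h).symm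
  obtain ⟨w, hw⟩ := OnePoint.ne_infty_iff_exists.mp hz'
  have hw0 : w ≠ 0 := by
    rintro rfl; rw [← hb2] at hw; exact hyz (MulAction.injective b hw)
  rw [hac, aff_coe, OnePoint.coe_eq_coe] at h2
  rw [hac, ← hw, aff_coe, OnePoint.coe_eq_coe] at h3
  have hc : c = 0 := by simpa using h2
  subst hc
  have ha : a = 1 := by
    apply Units.ext
    have : (a : K) * w = 1 * w := by linear_combination h3
    exact mul_right_cancel₀ hw0 this
  rw [ha, aff_one] at hac
  rwa [conj_eq_one_iff] at hac

/-- the commutator of two elements fixing `x` is trivial or fixes only `x` -/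
lemma comm_fix {g h : PGL2 K} {x : OnePoint K} (hg : g • x = x) (hh : h • x = x)
    {y : OnePoint K} (hy : (g * h * g⁻¹ * h⁻¹) • y = y) (hxy : x ≠ y) : g * h = h * g := by
  obtain ⟨b, hb1, hb2⟩ := exists_move x y hxy
  have h1 := (conj_fix b g x).2 hg
  have h2 := (conj_fix b h x).2 hh
  have h3 := (conj_fix b _ y).2 hy
  rw [hb1] at h1 h2
  rw [hb2] at h3
  obtain ⟨a, c, hac⟩ := exists_aff h1
  obtain ⟨a', c', hac'⟩ := exists_aff h2
  have e : b * (g * h * g⁻¹ * h⁻¹) * b⁻¹ =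
    (b * g * b⁻¹) * (b * h * b⁻¹) * (b * g * b⁻¹)⁻¹ * (b * h * b⁻¹)⁻¹ := by group
  have e1 : b * (g * h * g⁻¹ * h⁻¹) * b⁻¹ = 1 := by
    rw [e, hac, hac'] at h3 ⊢
    simp only [aff_inv, aff_mul, aff_coe, OnePoint.coe_eq_coe] at h3 ⊢
    rw [← aff_one, aff_inj]
    constructor
    · rw [mul_comm a a']; group
    · simpa using h3
  rw [conj_eq_one_iff] at e1
  have : g * h = (g * h * g⁻¹ * h⁻¹) * (h * g) := by group
  rw [this, e1, one_mul]

lemma exists_fix [IsAlgClosed K] (g : PGL2 K) : ∃ x : OnePoint K, g • x = x := by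
  induction g using QuotientGroup.induction_on with | H A =>
  by_cases h10 : A 1 0 = 0
  · exact ⟨∞, smul_inf0 _ h10⟩
  obtain ⟨z, hz⟩ : ∃ z, A 1 0 * z * z + (A 1 1 - A 0 0) * z + (- A 0 1) = 0 := by
    have hdeg : (Polynomial.C (A 1 0) * Polynomial.X ^ 2 + Polynomial.C (A 1 1 - A 0 0) * Polynomial.X
      + Polynomial.C (- A 0 1)).degree = 2 := Polynomial.degree_quadratic h10
    obtain ⟨z, hz⟩ := IsAlgClosed.exists_root _ (by rw [hdeg]; decide)
    refine ⟨z, ?_⟩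
    simp only [Polynomial.IsRoot, Polynomial.eval_add, Polynomial.eval_mul, Polynomial.eval_C,
      Polynomial.eval_X, Polynomial.eval_pow] at hz
    linear_combination hz
  have hne : A 1 0 * z + A 1 1 ≠ 0 := by
    intro h0
    have hd := det_ne A
    apply hd
    have e : A 0 0 * z + A 0 1 = 0 := by linear_combination z * h0 - hz
    have : A 1 0 * (A 0 0 * A 1 1 - A 0 1 * A 1 0) = 0 := by
      linear_combination (A 0 0 * A 1 0) * h0 - A 1 0 * A 1 0 * e
    exact (mul_eq_zero.mp this).resolve_left h10
  refine ⟨z, ?_⟩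
  rw [smul_coe1 _ _ hne, OnePoint.coe_eq_coe, div_eq_iff hne]
  linear_combination -hz

end basic

end Dick
namespace Dick

open OnePoint

section count

variable {K : Type} [Field K]

/-- conjugate subgroup -/
def cj (b : PGL2 K) (G : Subgroup (PGL2 K)) : Subgroup (PGL2 K) :=
  G.map (MulAut.conj b).toMonoidHom

lemma mem_cj {b : PGL2 K} {G : Subgroup (PGL2 K)} {h : PGL2 K} :
    h ∈ cj b G ↔ b⁻¹ * h * b ∈ G := by
  constructor
  · rintro ⟨g, hg, rfl⟩
    have : b⁻¹ * (b * g * b⁻¹) * b = g := by group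
    simpa [this] using hg
  · intro hh
    refine ⟨_, hh, ?_⟩
    simp [mul_assoc]

lemma conj_mem_cj {b : PGL2 K} {G : Subgroup (PGL2 K)} {h : PGL2 K} (hh : h ∈ G) :
    b * h * b⁻¹ ∈ cj b G := by
  rw [mem_cj]
  have : b⁻¹ * (b * h * b⁻¹) * b = h := by group
  rwa [this]

noncomputable def cjEquiv (b : PGL2 K) (G : Subgroup (PGL2 K)) : G ≃* cj b G :=
  G.equivMapOfInjective _ (MulAut.conj b).injective

instance (b : PGL2 K) (G : Subgroup (PGL2 K)) [Finite G] : Finite (cj b G) :=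
  Finite.of_equiv _ (cjEquiv b G).toEquiv

lemma cj_self {G : Subgroup (PGL2 K)} {b : PGL2 K} (hb : b ∈ G) : cj b G = G := by
  ext h
  rw [mem_cj]
  constructor
  · intro hh
    have := G.mul_mem (G.mul_mem hb hh) (G.inv_mem hb)
    have e : b * (b⁻¹ * h * b) * b⁻¹ = h := by group
    rwa [e] at this
  · intro hh
    exact G.mul_mem (G.mul_mem (G.inv_mem hb) hh) hb

/-- stabilizer in `G` -/
noncomputable def st (G : Subgroup (PGL2 K)) (x : OnePoint K) : Subgroup (PGL2 K) :=
  G ⊓ MulAction.stabilizer (PGL2 K) x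

lemma mem_st {G : Subgroup (PGL2 K)} {x : OnePoint K} {g : PGL2 K} :
    g ∈ st G x ↔ g ∈ G ∧ g • x = x := Iff.rfl

instance (G : Subgroup (PGL2 K)) [Finite G] (x : OnePoint K) : Finite (st G x) :=
  Finite.Set.subset (G : Set (PGL2 K)) (fun _ h => h.1)

/-- order of stabilizer -/
noncomputable def e (G : Subgroup (PGL2 K)) (x : OnePoint K) : ℕ := Nat.card (st G x)

/-- nontrivial elements whose only fixed point is `x` -/
def U (G : Subgroup (PGL2 K)) (x : OnePoint K) : Set (PGL2 K) :=
  {g | g ∈ G ∧ g ≠ 1 ∧ ∀ y : OnePoint K, g • y = y ↔ y = x}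

noncomputable def u (G : Subgroup (PGL2 K)) (x : OnePoint K) : ℕ := (U G x).ncard + 1

lemma st_cj (b : PGL2 K) (G : Subgroup (PGL2 K)) (x : OnePoint K) :
    st (cj b G) (b • x) = cj b (st G x) := by
  ext h
  rw [mem_st, mem_cj, mem_cj, mem_st, ← conj_fix b (b⁻¹ * h * b) x]
  have : b * (b⁻¹ * h * b) * b⁻¹ = h := by group
  rw [this]

lemma e_cj (b : PGL2 K) (G : Subgroup (PGL2 K)) (x : OnePoint K) :
    e (cj b G) (b • x) = e G x := by
  rw [e, st_cj]
  exact Nat.card_congr (cjEquiv b _).symm.toEquiv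

lemma u_cj (b : PGL2 K) (G : Subgroup (PGL2 K)) (x : OnePoint K) :
    u (cj b G) (b • x) = u G x := by
  rw [u, u]
  congr 1
  have : U (cj b G) (b • x) = (MulAut.conj b) '' (U G x) := by
    ext h
    constructor
    · rintro ⟨h1, h2, h3⟩
      refine ⟨b⁻¹ * h * b, ⟨mem_cj.1 h1, ?_, ?_⟩, by simp [mul_assoc]⟩
      · intro hh
        apply h2
        have : b * (b⁻¹ * h * b) * b⁻¹ = h := by group
        rw [← this, hh]; simp
      · intro y
        rw [← conj_fix b]
        have : b * (b⁻¹ * h * b) * b⁻¹ = h := by group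
        rw [this, h3]
        exact (MulAction.injective b).eq_iff
    · rintro ⟨g, ⟨h1, h2, h3⟩, rfl⟩
      refine ⟨by simpa using conj_mem_cj h1, by simpa using h2, ?_⟩
      intro y
      have := conj_fix b g (b⁻¹ • y)
      rw [smul_inv_smul] at this
      rw [MulAut.conj_apply, this, h3, inv_smul_eq_iff]
  rw [this, Set.ncard_image_of_injective _ (MulAut.conj b).injective]

lemma e_smul {G : Subgroup (PGL2 K)} {g : PGL2 K} (hg : g ∈ G) (x : OnePoint K) :
    e G (g • x) = e G x := by
  conv_lhs => rw [← cj_self hg]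
  exact e_cj _ _ _

lemma u_smul {G : Subgroup (PGL2 K)} {g : PGL2 K} (hg : g ∈ G) (x : OnePoint K) :
    u G (g • x) = u G x := by
  conv_lhs => rw [← cj_self hg]
  exact u_cj _ _ _

lemma e_orbit {G : Subgroup (PGL2 K)} {x y : OnePoint K} (h : x ∈ MulAction.orbit G y) :
    e G x = e G y := by
  obtain ⟨g, rfl⟩ := h
  exact e_smul g.2 y

lemma u_orbit {G : Subgroup (PGL2 K)} {x y : OnePoint K} (h : x ∈ MulAction.orbit G y) :
    u G x = u G y := by
  obtain ⟨g, rfl⟩ := h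
  exact u_smul g.2 y

lemma e_pos (G : Subgroup (PGL2 K)) [Finite G] (x : OnePoint K) : 0 < e G x := Nat.card_pos

lemma orbit_mul_e (G : Subgroup (PGL2 K)) (x : OnePoint K) :
    (MulAction.orbit G x).ncard * e G x = Nat.card G := by
  have h1 := Nat.card_congr (MulAction.orbitProdStabilizerEquivGroup G x)
  rw [Nat.card_prod] at h1
  rw [← h1]
  congr 1
  refine Nat.card_congr ⟨fun g => ⟨⟨g.1, g.2.1⟩, g.2.2⟩, fun g => ⟨g.1.1, g.1.2, g.2⟩, ?_, ?_⟩
  · intro g; rfl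
  · intro g; rfl

lemma e_dvd (G : Subgroup (PGL2 K)) (x : OnePoint K) : e G x ∣ Nat.card G :=
  ⟨_, by rw [mul_comm]; exact (orbit_mul_e G x).symm⟩

lemma two_le_e {G : Subgroup (PGL2 K)} [Finite G] {x : OnePoint K} :
    2 ≤ e G x ↔ ∃ g ∈ G, g ≠ 1 ∧ g • x = x := by
  have : 2 ≤ e G x ↔ 1 < e G x := Iff.rfl
  rw [this, e, Finite.one_lt_card_iff_nontrivial, Subgroup.nontrivial_iff_exists_ne_one]
  constructor
  · rintro ⟨g, hg, h1⟩; exact ⟨g, hg.1, h1, hg.2⟩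
  · rintro ⟨g, hg, h1, h2⟩; exact ⟨g, ⟨hg, h2⟩, h1⟩

lemma fix_cases [IsAlgClosed K] {g : PGL2 K} (hg : g ≠ 1) :
    (∃ x, {x : OnePoint K | g • x = x} = {x}) ∨
    (∃ x y, x ≠ y ∧ {x : OnePoint K | g • x = x} = {x, y}) := by
  obtain ⟨x, hx⟩ := exists_fix g
  by_cases h : ∃ y, y ≠ x ∧ g • y = y
  · obtain ⟨y, hyx, hy⟩ := h
    refine Or.inr ⟨x, y, hyx.symm, ?_⟩
    ext z
    constructor
    · intro hz
      by_contra hc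
      simp only [Set.mem_insert_iff, Set.mem_singleton_iff, not_or] at hc
      exact hg (fix3 hyx.symm (Ne.symm hc.1) (Ne.symm hc.2) hx hy hz)
    · rintro (rfl | rfl)
      · exact hx
      · exact hy
  · push Not at h
    refine Or.inl ⟨x, ?_⟩
    ext z
    constructor
    · intro hz
      by_contra hc
      exact h z hc hz
    · rintro rfl; exact hx

open Classical in
theorem count [IsAlgClosed K] (G : Subgroup (PGL2 K)) [Finite G] :
    ∃ R : Finset (OnePoint K), (∀ x ∈ R, 2 ≤ e G x) ∧
      (∀ x ∈ R, ∀ y ∈ R, x ∈ MulAction.orbit G y → x = y) ∧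
      (∀ x, 2 ≤ e G x → ∃ y ∈ R, x ∈ MulAction.orbit G y) ∧
      ∑ x ∈ R, (((e G x : ℚ) + u G x - 2) / e G x) = 2 - 2 / Nat.card G := by
  set F : Finset (PGL2 K) := (Set.toFinite (G : Set (PGL2 K))).toFinset.erase 1 with hF
  have memF : ∀ g, g ∈ F ↔ g ≠ 1 ∧ g ∈ G := by intro g; simp [hF]
  have cardF : F.card + 1 = Nat.card G := by
    rw [hF, Finset.card_erase_add_one (by simp [G.one_mem]), ← Set.ncard_eq_toFinset_card _ (Set.toFinite _)]
    rfl
  have hfin : {x : OnePoint K | ∃ g ∈ F, g • x = x}.Finite := by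
    have : {x : OnePoint K | ∃ g ∈ F, g • x = x} = ⋃ g ∈ F, {x : OnePoint K | g • x = x} := by
      ext; simp
    rw [this]
    refine Set.Finite.biUnion F.finite_toSet ?_
    intro g hg
    rcases fix_cases ((memF g).1 hg).1 with ⟨x, hx⟩ | ⟨x, y, _, hx⟩ <;> rw [hx] <;> simp
  set Ω := hfin.toFinset with hΩ
  have memΩ : ∀ x, x ∈ Ω ↔ 2 ≤ e G x := by
    intro x
    rw [two_le_e]
    simp only [hΩ, Set.Finite.mem_toFinset, Set.mem_ofPred_eq, memF]
    constructor
    · rintro ⟨g, ⟨h1, h2⟩, h3⟩; exact ⟨g, h2, h1, h3⟩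
    · rintro ⟨g, h2, h1, h3⟩; exact ⟨g, ⟨h1, h2⟩, h3⟩
  let w : PGL2 K → ℕ := fun g => if ({x : OnePoint K | g • x = x}).ncard = 1 then 2 else 1
  have hw : ∀ g ∈ F, ∑ x ∈ Ω with g • x = x, w g = 2 := by
    intro g hg
    have hs : ((Ω.filter (fun x => g • x = x) : Finset (OnePoint K)) : Set (OnePoint K))
        = {x : OnePoint K | g • x = x} := by
      ext x
      simp only [Finset.coe_filter, Set.mem_ofPred_eq, and_iff_right_iff_imp]
      intro h
      simp only [hΩ, Set.Finite.mem_toFinset, Set.mem_ofPred_eq]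
      exact ⟨g, hg, h⟩
    rw [Finset.sum_const, smul_eq_mul, ← Set.ncard_coe_finset, hs]
    rcases fix_cases ((memF g).1 hg).1 with ⟨x, hx⟩ | ⟨x, y, hxy, hx⟩
    · simp [w, hx]
    · have : ({x, y} : Set (OnePoint K)).ncard = 2 := Set.ncard_pair hxy
      simp only [w, hx, this]; norm_num
  have hd : ∀ x, (∑ g ∈ F with g • x = x, w g) + 2 = e G x + u G x := by
    intro x
    have hst : (st G x : Set (PGL2 K)).Finite :=
      (Set.toFinite (G : Set (PGL2 K))).subset (fun _ h => h.1)
    have h1 : (F.filter (fun g => g • x = x)).card + 1 = e G x := by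
      have : (F.filter (fun g => g • x = x)) =
          (hst.toFinset).erase 1 := by
        ext g
        simp only [Finset.mem_filter, memF, Finset.mem_erase, Set.Finite.mem_toFinset,
          SetLike.mem_coe, mem_st, and_assoc]
      rw [this, Finset.card_erase_add_one (by simp [(st G x).one_mem]),
        ← Set.ncard_eq_toFinset_card _ hst]
      rfl
    have h2 : ((F.filter (fun g => g • x = x)).filter
        (fun g => ({x : OnePoint K | g • x = x}).ncard = 1)).card + 1 = u G x := by
      rw [u, ← Set.ncard_coe_finset]
      congr 2
      ext g
      simp only [Finset.coe_filter, Finset.mem_filter, memF, Set.mem_ofPred_eq, U]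
      constructor
      · rintro ⟨⟨⟨a, b⟩, c⟩, d⟩
        refine ⟨b, a, ?_⟩
        obtain ⟨y, hy⟩ := Set.ncard_eq_one.1 d
        have hxy : x ∈ ({y} : Set (OnePoint K)) := by rw [← hy]; exact c
        rw [Set.mem_singleton_iff] at hxy
        subst hxy
        intro z
        exact Set.ext_iff.1 hy z
      · rintro ⟨b, a, h⟩
        refine ⟨⟨⟨a, b⟩, (h x).2 rfl⟩, ?_⟩
        rw [Set.ncard_eq_one]
        exact ⟨x, Set.ext h⟩
    rw [← h1, ← h2]
    have : ∀ g, w g = 1 + if ({x : OnePoint K | g • x = x}).ncard = 1 then 1 else 0 := by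
      intro g; simp only [w]; split_ifs <;> rfl
    simp_rw [this]
    rw [Finset.sum_add_distrib, Finset.sum_const, ← Finset.sum_filter, Finset.sum_const]
    simp
    omega
  have tot : ∑ x ∈ Ω, ((e G x : ℚ) + u G x - 2) = 2 * ((Nat.card G : ℚ) - 1) := by
    have h1 : ∀ x, ((e G x : ℚ) + u G x - 2) = ((∑ g ∈ F with g • x = x, w g : ℕ) : ℚ) := by
      intro x
      have := hd x
      have h2 : (((∑ g ∈ F with g • x = x, w g : ℕ) : ℚ) + 2) = e G x + u G x := by exact_mod_cast this
      linarith
    simp_rw [h1]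
    rw [← Nat.cast_sum]
    have h3 : ∑ x ∈ Ω, ∑ g ∈ F with g • x = x, w g = F.card * 2 := by
      rw [← smul_eq_mul, ← Finset.sum_const, ← Finset.sum_congr rfl hw]
      simp_rw [Finset.sum_filter]
      exact Finset.sum_comm
    rw [h3, ← cardF]
    push_cast
    ring
  let r : OnePoint K → OnePoint K := fun x =>
    Quotient.out (Quotient.mk (MulAction.orbitRel G (OnePoint K)) x)
  have hr : ∀ x, r x ∈ MulAction.orbit G x := by
    intro x
    exact MulAction.orbitRel_apply.1 (Quotient.exact (Quotient.out_eq _))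
  have hr2 : ∀ x y, x ∈ MulAction.orbit G y → r x = r y := by
    intro x y h
    simp only [r]
    congr 1
    exact Quotient.sound (MulAction.orbitRel_apply.2 h)
  have hr3 : ∀ x, r (r x) = r x := fun x => hr2 _ _ (hr x)
  have hΩr : ∀ x, x ∈ Ω → r x ∈ Ω := by
    intro x hx
    rw [memΩ] at hx ⊢
    rwa [e_orbit (hr x)]
  refine ⟨Ω.image r, ?_, ?_, ?_, ?_⟩
  · intro x hx
    obtain ⟨y, hy, rfl⟩ := Finset.mem_image.1 hx
    exact (memΩ _).1 (hΩr y hy)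
  · intro x hx y hy h
    obtain ⟨x', hx', rfl⟩ := Finset.mem_image.1 hx
    obtain ⟨y', hy', rfl⟩ := Finset.mem_image.1 hy
    have := hr2 _ _ h
    rwa [hr3, hr3] at this
  · intro x hx
    exact ⟨r x, Finset.mem_image_of_mem _ ((memΩ _).2 hx), MulAction.mem_orbit_symm.1 (hr x)⟩
  · have hg : (0 : ℚ) < Nat.card G := by exact_mod_cast Nat.card_pos
    have key : ∑ x ∈ Ω.image r, (((e G x : ℚ) + u G x - 2) / e G x) * Nat.card G
        = 2 * ((Nat.card G : ℚ) - 1) := by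
      rw [← tot, ← Finset.sum_fiberwise_of_maps_to (g := r) (t := Ω.image r)
        (fun x hx => Finset.mem_image_of_mem _ hx)]
      refine Finset.sum_congr rfl ?_
      intro y hy
      obtain ⟨y', hy', rfl⟩ := Finset.mem_image.1 hy
      have hs : ((Ω.filter (fun x => r x = r y') : Finset _) : Set (OnePoint K))
          = MulAction.orbit G (r y') := by
        ext x
        simp only [Finset.coe_filter, Set.mem_ofPred_eq]
        constructor
        · rintro ⟨_, h⟩
          rw [← h]
          exact MulAction.mem_orbit_symm.1 (hr x)
        · intro h
          refine ⟨?_, by rw [hr2 _ _ h, hr3]⟩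
          rw [memΩ, e_orbit h, ← memΩ]
          exact hΩr _ hy'
      have hc : ∑ x ∈ Ω with r x = r y', ((e G x : ℚ) + u G x - 2) =
          ∑ x ∈ Ω with r x = r y', ((e G (r y') : ℚ) + u G (r y') - 2) := by
        refine Finset.sum_congr rfl ?_
        intro x hx
        have : x ∈ MulAction.orbit G (r y') := by rw [← hs]; exact_mod_cast hx
        rw [e_orbit this, u_orbit this]
      rw [hc, Finset.sum_const, ← Set.ncard_coe_finset, hs, nsmul_eq_mul, ← orbit_mul_e G (r y')]
      have := e_pos G (r y')
      push_cast
      field_simp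
    rw [← Finset.sum_mul] at key
    field_simp
    linarith

end count
end Dick
namespace Dick

section abstract_groups

lemma free_dvd {G X : Type} [Group G] [MulAction G X] (L : Subgroup G) (S : Set X)
    (h1 : ∀ g ∈ L, ∀ x ∈ S, g • x ∈ S) (h2 : ∀ g ∈ L, ∀ x ∈ S, g • x = x → g = 1) :
    Nat.card L ∣ S.ncard := by
  letI : MulAction L S :=
    { smul := fun g x => ⟨g.1 • x.1, h1 _ g.2 _ x.2⟩
      one_smul := fun x => Subtype.ext (one_smul G x.1)
      mul_smul := fun g h x => Subtype.ext (mul_smul g.1 h.1 x.1) }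
  have hfree : ∀ b : S, MulAction.stabilizer L b = ⊥ := by
    intro b
    rw [eq_bot_iff]
    intro g hg
    have : g • b = b := hg
    have h3 : g.1 • b.1 = b.1 := congrArg Subtype.val this
    rw [Subgroup.mem_bot]
    exact Subtype.ext (h2 _ g.2 _ b.2 h3)
  have := Nat.card_congr (MulAction.selfEquivOrbitsQuotientProd hfree)
  rw [Nat.card_prod] at this
  exact ⟨_, by rw [mul_comm]; exact this⟩

lemma dihedral_abs {G : Type} [Group G] [Finite G] (C : Subgroup G) [IsCyclic C]
    (hi : C.index = 2) (hs : ∀ g, g ∉ C → g * g = 1) :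
    Nonempty (G ≃* DihedralGroup (Nat.card C)) := by
  set n := Nat.card C with hn
  haveI : NeZero n := ⟨Nat.card_pos.ne'⟩
  let ψ : Multiplicative (ZMod n) ≃* C := zmodCyclicMulEquiv (G := C) inferInstance
  obtain ⟨s, hsC⟩ : ∃ s, s ∉ C := by
    by_contra! h
    have : C = ⊤ := by ext; simp [h]
    rw [this, Subgroup.index_top] at hi
    omega
  have hss := hs s hsC
  have key : ∀ c ∈ C, c * s = s * c⁻¹ := by
    intro c hc
    have h1 : c * s ∉ C := fun h => hsC ((Subgroup.mul_mem_cancel_left C hc).1 h)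
    have h2 := hs _ h1
    have h3 : s⁻¹ = s := inv_eq_of_mul_eq_one_left hss
    rw [mul_eq_one_iff_eq_inv, mul_inv_rev, h3] at h2
    exact h2
  let f : DihedralGroup n → G := fun d => match d with
    | .r i => (ψ (Multiplicative.ofAdd i)).1
    | .sr i => s * (ψ (Multiplicative.ofAdd i)).1
  have fr : ∀ i, f (.r i) = (ψ (Multiplicative.ofAdd i)).1 := fun _ => rfl
  have fsr : ∀ i, f (.sr i) = s * (ψ (Multiplicative.ofAdd i)).1 := fun _ => rfl
  have ha : ∀ i j, ((ψ (Multiplicative.ofAdd (i + j))).1 : G) =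
      (ψ (Multiplicative.ofAdd i)).1 * (ψ (Multiplicative.ofAdd j)).1 := by
    intro i j
    rw [ofAdd_add, map_mul]; rfl
  have hneg : ∀ i, ((ψ (Multiplicative.ofAdd (-i))).1 : G) = ((ψ (Multiplicative.ofAdd i)).1)⁻¹ := by
    intro i
    rw [ofAdd_neg, map_inv]; rfl
  let F : DihedralGroup n →* G := MonoidHom.mk' f (by
    rintro (i | i) (j | j)
    · rw [DihedralGroup.r_mul_r, fr, fr, fr, ha]
    · rw [DihedralGroup.r_mul_sr, fr, fsr, fsr, sub_eq_neg_add, ha, hneg, ← mul_assoc, ← mul_assoc,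
        key _ (ψ (Multiplicative.ofAdd i)).2]
    · rw [DihedralGroup.sr_mul_r, fr, fsr, fsr, ha, mul_assoc]
    · rw [DihedralGroup.sr_mul_sr, fr, fsr, fsr, sub_eq_neg_add, ha, hneg, mul_assoc,
        ← mul_assoc _ s, key _ (ψ (Multiplicative.ofAdd i)).2, ← mul_assoc, ← mul_assoc, hss,
        one_mul])
  have hinj : Function.Injective F := by
    rw [injective_iff_map_eq_one]
    rintro (i | i) h
    · change (ψ (Multiplicative.ofAdd i)).1 = 1 at h
      have : ψ (Multiplicative.ofAdd i) = 1 := Subtype.ext h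
      rw [map_eq_one_iff _ ψ.injective] at this
      have : i = 0 := this
      rw [this]; rfl
    · change s * (ψ (Multiplicative.ofAdd i)).1 = 1 at h
      exfalso
      apply hsC
      rw [mul_eq_one_iff_eq_inv] at h
      rw [h]
      exact C.inv_mem (ψ (Multiplicative.ofAdd i)).2
  have hcard : Nat.card (DihedralGroup n) = Nat.card G := by
    rw [DihedralGroup.nat_card, ← C.index_mul_card, hi]
  have hb : Function.Bijective F := (Nat.bijective_iff_injective_and_card F).2 ⟨hinj, hcard⟩
  exact ⟨(MulEquiv.ofBijective F hb).symm⟩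

lemma emb_perm {G Y : Type} [Group G] [Finite Y] (f : G →* Equiv.Perm Y)
    (hf : Function.Injective f) (m : ℕ) (hY : Nat.card Y = m) :
    ∃ F : G →* Equiv.Perm (Fin m), Function.Injective F := by
  subst hY
  let ε : Y ≃ Fin (Nat.card Y) := Finite.equivFin Y
  exact ⟨ε.permCongrHom.toMonoidHom.comp f, ε.permCongrHom.injective.comp hf⟩

lemma emb_full {G Y : Type} [Group G] [Finite Y] (f : G →* Equiv.Perm Y)
    (hf : Function.Injective f) (m : ℕ) (hY : Nat.card Y = m) (hG : Nat.card G = m.factorial) :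
    Nonempty (G ≃* Equiv.Perm (Fin m)) := by
  obtain ⟨F, hF⟩ := emb_perm f hf m hY
  have hb : Function.Bijective F := (Nat.bijective_iff_injective_and_card F).2
    ⟨hF, by rw [hG, Nat.card_perm, Nat.card_fin]⟩
  exact ⟨MulEquiv.ofBijective F hb⟩

lemma emb_alt {G Y : Type} [Group G] [Finite Y] (f : G →* Equiv.Perm Y)
    (hf : Function.Injective f) (m : ℕ) (hm : 2 ≤ m) (hY : Nat.card Y = m)
    (hG : 2 * Nat.card G = m.factorial) :
    Nonempty (G ≃* alternatingGroup (Fin m)) := by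
  obtain ⟨F, hF⟩ := emb_perm f hf m hY
  have hc : Nat.card F.range = Nat.card G := Nat.card_congr (MonoidHom.ofInjective hF).symm.toEquiv
  have hi : F.range.index = 2 := by
    have h1 := F.range.index_mul_card
    rw [Nat.card_perm, Nat.card_fin, ← hG, hc] at h1
    have : 0 < Nat.card G := by have := m.factorial_pos; omega
    exact Nat.eq_of_mul_eq_mul_right this h1
  have := Equiv.Perm.eq_alternatingGroup_of_index_eq_two hi
  exact ⟨(MonoidHom.ofInjective hF).trans (MulEquiv.subgroupCongr this)⟩

lemma card_ne_one (P : Type) [Group P] [Finite P] :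
    Nat.card {t : P // t ≠ 1} + 1 = Nat.card P := by
  classical
  have := Fintype.ofFinite P
  have h : 0 < Fintype.card P := Fintype.card_pos
  rw [Nat.card_eq_fintype_card, Nat.card_eq_fintype_card, Fintype.card_subtype_compl]
  simp
  omega

lemma a5_abs {G : Type} [Group G] [Finite G] (hG : Nat.card G = 60) (t₀ : G)
    (ht₀ : orderOf t₀ = 2) (hconj : ∀ t : G, orderOf t = 2 → ∃ g, t = g * t₀ * g⁻¹)
    (hC : Nat.card (Subgroup.centralizer {t₀}) ≤ 4) (h4 : ∀ g : G, orderOf g ≠ 4) :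
    Nonempty (G ≃* alternatingGroup (Fin 5)) := by
  haveI : Fact (Nat.Prime 2) := ⟨Nat.prime_two⟩
  have hPcard : ∀ P : Sylow 2 G, Nat.card P = 4 := by
    intro P
    rw [Sylow.card_eq_multiplicity, hG]
    have : (60 : ℕ) = 2 ^ 2 * 15 := by norm_num
    rw [this, Nat.factorization_mul (by norm_num) (by norm_num), Finsupp.add_apply,
      Nat.Prime.factorization_pow Nat.prime_two, Nat.factorization_eq_zero_of_not_dvd (by norm_num)]
    simp
  have hPinv : ∀ (P : Sylow 2 G), ∀ g ∈ P, g * g = 1 := by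
    intro P g hg
    have h1 : orderOf g ∣ 2 ^ 2 := by
      have := Subgroup.orderOf_dvd_natCard P.toSubgroup hg
      rwa [show Nat.card P.toSubgroup = 4 from hPcard P] at this
    obtain ⟨k, hk, hk2⟩ := (Nat.dvd_prime_pow Nat.prime_two).1 h1
    have : orderOf g ∣ 2 := by
      interval_cases k
      · simp [hk2]
      · simp [hk2]
      · exact absurd hk2 (by simpa using h4 g)
    rw [← pow_two]
    exact orderOf_dvd_iff_pow_eq_one.1 this
  have hPcomm : ∀ (P : Sylow 2 G), ∀ g ∈ P, ∀ h ∈ P, g * h = h * g := by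
    intro P g hg h hh
    have h1 := hPinv P _ (P.toSubgroup.mul_mem hg hh)
    have h2 : g⁻¹ = g := inv_eq_of_mul_eq_one_left (hPinv P g hg)
    have h3 : h⁻¹ = h := inv_eq_of_mul_eq_one_left (hPinv P h hh)
    rw [mul_eq_one_iff_eq_inv, mul_inv_rev, h2, h3] at h1
    exact h1
  have ho2 : ∀ (P : Sylow 2 G), ∀ g ∈ P, g ≠ 1 → orderOf g = 2 := by
    intro P g hg h1
    exact orderOf_eq_prime (by rw [pow_two]; exact hPinv P g hg) h1
  have hCt : ∀ t : G, orderOf t = 2 → Nat.card (Subgroup.centralizer {t}) ≤ 4 := by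
    intro t ht
    obtain ⟨g, rfl⟩ := hconj t ht
    refine le_trans (Nat.card_le_card_of_injective
      (fun x : Subgroup.centralizer {g * t₀ * g⁻¹} =>
        (⟨g⁻¹ * x.1 * g, ?_⟩ : Subgroup.centralizer {t₀})) ?_) hC
    · have := Subgroup.mem_centralizer_singleton_iff.1 x.2
      rw [Subgroup.mem_centralizer_singleton_iff]
      calc g⁻¹ * x.1 * g * t₀ = g⁻¹ * (x.1 * (g * t₀ * g⁻¹)) * g := by group
        _ = g⁻¹ * ((g * t₀ * g⁻¹) * x.1) * g := by rw [this]
        _ = _ := by group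
    · intro x y h
      have := congrArg Subtype.val h
      simp only [mul_left_inj, mul_right_inj] at this
      exact Subtype.ext this
  have hPC : ∀ (P : Sylow 2 G), ∀ t ∈ P, t ≠ 1 → P.toSubgroup = Subgroup.centralizer {t} := by
    intro P t ht h1
    apply Subgroup.eq_of_le_of_card_ge
    · intro g hg
      rw [Subgroup.mem_centralizer_singleton_iff]
      exact hPcomm P g hg t ht
    · rw [show Nat.card P.toSubgroup = 4 from hPcard P]
      exact hCt t (ho2 P t ht h1)
  have hex : ∀ t : G, orderOf t = 2 → ∃ P : Sylow 2 G, t ∈ P := by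
    intro t ht
    have : IsPGroup 2 (Subgroup.zpowers t) := by
      apply IsPGroup.of_card (n := 1)
      rw [Nat.card_zpowers, ht, pow_one]
    obtain ⟨P, hP⟩ := this.exists_le_sylow
    exact ⟨P, hP (Subgroup.mem_zpowers t)⟩
  -- number of involutions
  have hCcard : Nat.card (Subgroup.centralizer {t₀}) = 4 := by
    obtain ⟨P, hP⟩ := hex t₀ ht₀
    rw [← hPC P t₀ hP (by rintro rfl; simp at ht₀)]
    exact hPcard P
  have hInv : Nat.card {t : G // orderOf t = 2} = 15 := by
    have h1 := Nat.card_congr (MulAction.orbitProdStabilizerEquivGroup (ConjAct G) t₀)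
    rw [Nat.card_prod, show Nat.card (ConjAct G) = 60 from hG, ConjAct.stabilizer_eq_centralizer] at h1
    have h2 : Nat.card (Subgroup.centralizer {ConjAct.toConjAct t₀}) = 4 := hCcard
    rw [h2] at h1
    have h3 : Nat.card {t : G // orderOf t = 2} = Nat.card (MulAction.orbit (ConjAct G) t₀) := by
      refine Nat.card_congr (Equiv.subtypeEquivRight ?_)
      intro t
      constructor
      · intro ht
        obtain ⟨g, rfl⟩ := hconj t ht
        exact ⟨ConjAct.toConjAct g, by simp [ConjAct.smul_def]⟩
      · rintro ⟨g, rfl⟩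
        change orderOf (g • t₀) = 2
        rw [ConjAct.smul_def, ← ht₀]
        exact orderOf_injective (MulAut.conj (ConjAct.ofConjAct g)).toMonoidHom
          (MulAut.conj (ConjAct.ofConjAct g)).injective t₀
    omega
  have hn2 : Nat.card (Sylow 2 G) = 5 := by
    classical
    let Φ : (Σ P : Sylow 2 G, {t : P // t ≠ 1}) → {t : G // orderOf t = 2} :=
      fun x => ⟨x.2.1.1, ho2 x.1 _ x.2.1.2 (fun h => x.2.2 (Subtype.ext h))⟩
    have hΦ : Function.Bijective Φ := by
      constructor
      · rintro ⟨P, ⟨⟨t, ht⟩, h1⟩⟩ ⟨Q, ⟨⟨s, hs⟩, h2⟩⟩ h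
        have hts : t = s := congrArg Subtype.val h
        subst hts
        have h1' : t ≠ 1 := fun h => h1 (Subtype.ext h)
        have : P = Q := by
          apply Sylow.ext
          rw [hPC P t ht h1', hPC Q t hs h1']
        subst this
        rfl
      · rintro ⟨t, ht⟩
        obtain ⟨P, hP⟩ := hex t ht
        exact ⟨⟨P, ⟨⟨t, hP⟩, fun h => by
          have : t = 1 := congrArg Subtype.val h
          rw [this] at ht; simp at ht⟩⟩, rfl⟩
    have h1 := Nat.card_congr (Equiv.ofBijective Φ hΦ)
    rw [hInv] at h1
    haveI := Fintype.ofFinite (Sylow 2 G)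
    rw [Nat.card_sigma] at h1
    have h3 : ∀ P : Sylow 2 G, Nat.card {t : P // t ≠ 1} = 3 := by
      intro P
      have h6 : Nat.card {t : P // t ≠ 1} + 1 = 4 := (card_ne_one P).trans (hPcard P)
      omega
    simp_rw [h3] at h1
    rw [Finset.sum_const, smul_eq_mul, Finset.card_univ, ← Nat.card_eq_fintype_card] at h1
    omega
  have hker : Function.Injective (MulAction.toPermHom G (Sylow 2 G)) := by
    rw [injective_iff_map_eq_one]
    intro n₁ hn₁
    set N := (MulAction.toPermHom G (Sylow 2 G)).ker with hN
    have hn₁N : n₁ ∈ N := hn₁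
    have hNP : ∀ g ∈ N, ∀ P : Sylow 2 G, g ∈ Subgroup.normalizer (P : Set G) := by
      intro g hg P
      have h1 : MulAction.toPermHom G (Sylow 2 G) g = 1 := hg
      have h2 : g • P = P := by
        have := congrArg (fun σ => σ P) h1
        simpa using this
      exact Sylow.smul_eq_iff_mem_normalizer.1 h2
    obtain ⟨P, hP⟩ := hex t₀ ht₀
    have ht₀1 : t₀ ≠ 1 := by rintro rfl; simp at ht₀
    have hno : ∀ t ∈ N, orderOf t ≠ 2 := by
      intro t ht ht2
      obtain ⟨g, rfl⟩ := hconj t ht2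
      have ht₀N : t₀ ∈ N := by
        have := (inferInstance : N.Normal).conj_mem _ ht g⁻¹
        have e : g⁻¹ * (g * t₀ * g⁻¹) * g⁻¹⁻¹ = t₀ := by group
        rwa [e] at this
      have h1 : Nat.card {t : G // orderOf t = 2} ≤
          Nat.card (Subgroup.normalizer (P : Set G)) := by
        refine Nat.card_le_card_of_injective (fun t => ⟨t.1, ?_⟩) ?_
        · obtain ⟨h, hh⟩ := hconj t.1 t.2
          rw [hh]
          exact hNP _ ((inferInstance : N.Normal).conj_mem _ ht₀N h) P
        · intro a b h
          have := congrArg Subtype.val h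
          exact Subtype.ext this
      have h2 := P.card_eq_index_normalizer
      rw [hn2] at h2
      have h3 := (Subgroup.normalizer (P : Set G)).index_mul_card
      rw [← h2, hG] at h3
      rw [hInv] at h1
      omega
    have hc : n₁ * t₀ * n₁⁻¹ * t₀⁻¹ = 1 := by
      by_contra hne
      refine hno _ ?_ (ho2 P _ ?_ hne)
      · have h1 := (inferInstance : N.Normal).conj_mem _ (N.inv_mem hn₁N) t₀
        have h2 := N.mul_mem hn₁N h1
        have e : n₁ * (t₀ * n₁⁻¹ * t₀⁻¹) = n₁ * t₀ * n₁⁻¹ * t₀⁻¹ := by group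
        rwa [e] at h2
      · have h1 := (Subgroup.mem_normalizer_iff.1 (hNP _ hn₁N P) t₀).1 hP
        exact P.toSubgroup.mul_mem h1 (P.toSubgroup.inv_mem hP)
    have hcomm : n₁ ∈ Subgroup.centralizer {t₀} := by
      rw [Subgroup.mem_centralizer_singleton_iff]
      calc n₁ * t₀ = (n₁ * t₀ * n₁⁻¹ * t₀⁻¹) * (t₀ * n₁) := by group
        _ = _ := by rw [hc, one_mul]
    rw [← hPC P t₀ hP ht₀1] at hcomm
    by_contra hne
    exact hno _ hn₁N (ho2 P _ hcomm hne)
  exact emb_alt _ hker 5 (by norm_num) hn2 (by rw [hG]; rfl)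

end abstract_groups
end Dick
namespace Dick

open OnePoint

/-- the list of possible groups -/
def Concl (p : ℕ) [Fact p.Prime] (H : Type) [Group H] : Prop :=
    (∃ n : ℕ, ¬ p ∣ n ∧ Nonempty (H ≃* Multiplicative (ZMod n))) ∨
    (∃ n : ℕ, ¬ p ∣ n ∧ Nonempty (H ≃* DihedralGroup n)) ∨
    Nonempty (H ≃* alternatingGroup (Fin 4)) ∨
    Nonempty (H ≃* Equiv.Perm (Fin 4)) ∨
    Nonempty (H ≃* alternatingGroup (Fin 5)) ∨
    (∃ (t n : ℕ) (_ : n ∣ p ^ t - 1)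
      (φ : Multiplicative (ZMod n) →* MulAut (Multiplicative (Fin t → ZMod p))),
      (∀ c : Multiplicative (ZMod n), c ≠ 1 →
        ∀ e : Multiplicative (Fin t → ZMod p), φ c e = e → e = 1) ∧
      Nonempty (H ≃* (Multiplicative (Fin t → ZMod p)) ⋊[φ] Multiplicative (ZMod n))) ∨
    (∃ t : ℕ, 1 ≤ t ∧ Nonempty (H ≃* PSL2 (GaloisField p t))) ∨
    (∃ t : ℕ, 1 ≤ t ∧ Nonempty (H ≃* PGL2 (GaloisField p t)))

lemma Concl.congr {p : ℕ} [Fact p.Prime] {H H' : Type} [Group H] [Group H'] (f : H' ≃* H)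
    (h : Concl p H) : Concl p H' := by
  rcases h with ⟨n, h1, ⟨g⟩⟩ | ⟨n, h1, ⟨g⟩⟩ | ⟨⟨g⟩⟩ | ⟨⟨g⟩⟩ | ⟨⟨g⟩⟩ | ⟨t, n, h1, φ, h2, ⟨g⟩⟩ |
    ⟨t, h1, ⟨g⟩⟩ | ⟨t, h1, ⟨g⟩⟩
  · exact Or.inl ⟨n, h1, ⟨f.trans g⟩⟩
  · exact Or.inr (Or.inl ⟨n, h1, ⟨f.trans g⟩⟩)
  · exact Or.inr (Or.inr (Or.inl ⟨f.trans g⟩))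
  · exact Or.inr (Or.inr (Or.inr (Or.inl ⟨f.trans g⟩)))
  · exact Or.inr (Or.inr (Or.inr (Or.inr (Or.inl ⟨f.trans g⟩))))
  · exact Or.inr (Or.inr (Or.inr (Or.inr (Or.inr (Or.inl ⟨t, n, h1, φ, h2, ⟨f.trans g⟩⟩)))))
  · exact Or.inr (Or.inr (Or.inr (Or.inr (Or.inr (Or.inr (Or.inl ⟨t, h1, ⟨f.trans g⟩⟩))))))
  · exact Or.inr (Or.inr (Or.inr (Or.inr (Or.inr (Or.inr (Or.inr ⟨t, h1, ⟨f.trans g⟩⟩))))))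

section borel
variable {K : Type} [Field K]

/-- translations in `G` -/
def tA (G : Subgroup (PGL2 K)) : AddSubgroup K where
  carrier := {b | aff 1 b ∈ G}
  zero_mem' := by simp [aff_one, G.one_mem]
  add_mem' := by
    intro a b ha hb
    have := G.mul_mem ha hb
    rw [aff_mul] at this
    simpa [add_comm] using this
  neg_mem' := by
    intro a ha
    have := G.inv_mem ha
    rw [aff_inv] at this
    simpa using this

lemma mem_tA {G : Subgroup (PGL2 K)} {b : K} : b ∈ tA G ↔ aff 1 b ∈ G := Iff.rfl

/-- homotheties in `G` -/
def tD (G : Subgroup (PGL2 K)) : Subgroup Kˣ where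
  carrier := {a | aff a 0 ∈ G}
  one_mem' := by simp [aff_one, G.one_mem]
  mul_mem' := by
    intro a b ha hb
    have := G.mul_mem ha hb
    rw [aff_mul] at this
    simpa using this
  inv_mem' := by
    intro a ha
    have := G.inv_mem ha
    rw [aff_inv] at this
    simpa using this

lemma mem_tD {G : Subgroup (PGL2 K)} {a : Kˣ} : a ∈ tD G ↔ aff a 0 ∈ G := Iff.rfl

instance (G : Subgroup (PGL2 K)) [Finite G] : Finite (tA G) :=
  Finite.of_injective (fun b : tA G => (⟨aff 1 b.1, b.2⟩ : G)) (by
    intro a b h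
    have := congrArg Subtype.val h
    exact Subtype.ext (aff_inj.1 this).2)

instance (G : Subgroup (PGL2 K)) [Finite G] : Finite (tD G) :=
  Finite.of_injective (fun b : tD G => (⟨aff b.1 0, b.2⟩ : G)) (by
    intro a b h
    have := congrArg Subtype.val h
    exact Subtype.ext (aff_inj.1 this).1)

lemma tD_mul_tA {G : Subgroup (PGL2 K)} {a : Kˣ} {b : K} (ha : a ∈ tD G) (hb : b ∈ tA G) :
    (a : K) * b ∈ tA G := by
  have := G.mul_mem (G.mul_mem ha hb) (G.inv_mem ha)
  rw [aff_inv, aff_mul, aff_mul] at this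
  rw [mem_tA]
  simpa using this

lemma card_tD_dvd (G : Subgroup (PGL2 K)) [Finite G] :
    Nat.card (tD G) ∣ Nat.card (tA G) - 1 := by
  have h := free_dvd (tD G) ((tA G : Set K) \ {0}) (by
    intro g hg x hx
    exact ⟨tD_mul_tA hg hx.1, by
      intro h
      have h' : (g : K) * x = 0 := h
      rcases mul_eq_zero.1 h' with h | h
      · exact g.ne_zero h
      · exact hx.2 h⟩) (by
    intro g hg x hx h
    have h' : (g : K) * x = x := h
    have : (g : K) = 1 := by
      have hx0 : x ≠ 0 := hx.2
      exact (mul_eq_right₀ hx0).1 h'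
    exact Units.ext this)
  rwa [Set.ncard_diff_singleton_of_mem (tA G).zero_mem] at h

lemma elem_ab0 (p : ℕ) [Fact p.Prime] (A : Type) [AddCommGroup A] [Module (ZMod p) A] [Finite A] :
    ∃ t, Nat.card A = p ^ t ∧ Nonempty ((Fin t → ZMod p) ≃+ A) := by
  let b := Module.finBasis (ZMod p) A
  refine ⟨Module.finrank (ZMod p) A, ?_, ⟨b.equivFun.symm.toAddEquiv⟩⟩
  rw [Nat.card_congr b.equivFun.toEquiv]
  simp

lemma elem_ab (p : ℕ) [Fact p.Prime] [CharP K p] (A : AddSubgroup K) [Finite A] :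
    ∃ t, Nat.card A = p ^ t ∧ Nonempty ((Fin t → ZMod p) ≃+ A) :=
  @elem_ab0 p _ A _ (AddCommGroup.zmodModule (n := p) (by
    intro x
    apply Subtype.ext
    simp)) _

lemma borel0 (p : ℕ) [Fact p.Prime] [CharP K p] (G : Subgroup (PGL2 K)) [Finite G]
    (hfix : ∀ g ∈ G, g • (∞ : OnePoint K) = ∞)
    (hN : ∀ a b, aff a b ∈ G → aff a 0 ∈ G) : Concl p G := by
  obtain ⟨t, ht, ⟨eA⟩⟩ := elem_ab p (tA G)
  set n := Nat.card (tD G) with hn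
  have hcyc : IsCyclic (tD G) := inferInstance
  let eD : Multiplicative (ZMod n) ≃* tD G := zmodCyclicMulEquiv (G := tD G) hcyc
  have hdvd : n ∣ p ^ t - 1 := by rw [← ht]; exact card_tD_dvd G
  let act : Multiplicative (ZMod n) → Multiplicative (Fin t → ZMod p) →
    Multiplicative (Fin t → ZMod p) := fun c x =>
      Multiplicative.ofAdd (eA.symm ⟨((eD c).1 : K) * (eA x.toAdd).1,
        tD_mul_tA (eD c).2 (eA x.toAdd).2⟩)
  have hact : ∀ c x, (eA (act c x).toAdd).1 = ((eD c).1 : K) * (eA x.toAdd).1 := by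
    intro c x
    simp [act]
  have hext : ∀ x y : Multiplicative (Fin t → ZMod p),
      (eA x.toAdd).1 = (eA y.toAdd).1 → x = y := by
    intro x y h
    exact Multiplicative.toAdd.injective (eA.injective (Subtype.ext h))
  have hmul : ∀ c d x, act (c * d) x = act c (act d x) := by
    intro c d x
    apply hext
    rw [hact, hact, hact, map_mul]
    simp [mul_assoc]
  have hone : ∀ x, act 1 x = x := by
    intro x
    apply hext
    rw [hact, map_one]
    simp
  let φ : Multiplicative (ZMod n) →* MulAut (Multiplicative (Fin t → ZMod p)) :=
    { toFun := fun c =>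
        { toFun := act c
          invFun := act c⁻¹
          left_inv := fun x => by rw [← hmul, inv_mul_cancel, hone]
          right_inv := fun x => by rw [← hmul, mul_inv_cancel, hone]
          map_mul' := fun x y => by
            apply hext
            rw [hact, toAdd_mul, toAdd_mul, map_add, map_add]
            simp only [AddSubgroup.coe_add]
            rw [hact, hact, mul_add] }
      map_one' := by
        ext1 x
        exact hone x
      map_mul' := fun c d => by
        ext1 x
        exact hmul c d x }
  have hφ : ∀ c x, φ c x = act c x := fun _ _ => rfl
  refine Or.inr (Or.inr (Or.inr (Or.inr (Or.inr (Or.inl ⟨t, n, hdvd, φ, ?_, ?_⟩)))))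
  · intro c hc x hx
    rw [hφ] at hx
    have h1 := hact c x
    rw [hx] at h1
    by_contra hx1
    apply hc
    have h0 : (eA x.toAdd).1 ≠ 0 := by
      intro h
      apply hx1
      apply hext
      rw [h]; simp
    have h2 := (mul_eq_right₀ h0).1 h1.symm
    apply eD.injective
    rw [map_one]
    exact Subtype.ext (Units.ext h2)
  · have hmem : ∀ a ∈ tD G, ∀ b ∈ tA G, aff a b ∈ G := by
      intro a ha b hb
      have := G.mul_mem hb ha
      rw [aff_mul] at this
      simpa using this
    let f : (Multiplicative (Fin t → ZMod p)) ⋊[φ] Multiplicative (ZMod n) →* G :=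
      MonoidHom.mk' (fun x => ⟨aff (eD x.right).1 (eA x.left.toAdd).1,
        hmem _ (eD x.right).2 _ (eA x.left.toAdd).2⟩) (by
        intro x y
        apply Subtype.ext
        simp only [SemidirectProduct.mul_left, SemidirectProduct.mul_right, map_mul,
          toAdd_mul, map_add, hφ, AddSubgroup.coe_add, Subgroup.coe_mul, hact]
        rw [aff_mul, add_comm])
    have hf : Function.Bijective f := by
      constructor
      · intro x y h
        have h1 := aff_inj.1 (congrArg Subtype.val h)
        refine SemidirectProduct.ext (hext _ _ h1.2) (eD.injective (Subtype.ext h1.1))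
      · rintro ⟨g, hg⟩
        obtain ⟨a, b, rfl⟩ := exists_aff (hfix g hg)
        have ha : a ∈ tD G := hN a b hg
        have hb : b ∈ tA G := by
          have := G.mul_mem hg (G.inv_mem ha)
          rw [aff_inv, aff_mul] at this
          rw [mem_tA]; simpa using this
        refine ⟨⟨Multiplicative.ofAdd (eA.symm ⟨b, hb⟩), eD.symm ⟨a, ha⟩⟩, ?_⟩
        apply Subtype.ext
        simp [f]
    exact ⟨(MulEquiv.ofBijective f hf).symm⟩

lemma cj_trans (v : K) (a : Kˣ) (b : K) (G : Subgroup (PGL2 K)) :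
    aff a b ∈ cj (aff 1 v) G ↔ aff a (a * v + b - v) ∈ G := by
  rw [mem_cj, aff_inv, aff_mul, aff_mul]
  have : ((1 : Kˣ)⁻¹ * a * 1) = a := by simp
  rw [this]
  have h2 : (((1 : Kˣ)⁻¹ * a : Kˣ) : K) * v + (((1 : Kˣ)⁻¹ : Kˣ) * b + -((1 : Kˣ)⁻¹ : Kˣ) * v)
    = a * v + b - v := by simp; ring
  rw [h2]

lemma norm0 (G : Subgroup (PGL2 K)) [Finite G] : ∃ v : K, ∀ a b, aff a b ∈ cj (aff 1 v) G →
    aff a 0 ∈ cj (aff 1 v) G := by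
  let D : Subgroup Kˣ :=
    { carrier := {a | ∃ b, aff a b ∈ G}
      one_mem' := ⟨0, by rw [aff_one]; exact G.one_mem⟩
      mul_mem' := by
        rintro a a' ⟨b, hb⟩ ⟨b', hb'⟩
        have := G.mul_mem hb hb'
        rw [aff_mul] at this
        exact ⟨_, this⟩
      inv_mem' := by
        rintro a ⟨b, hb⟩
        have := G.inv_mem hb
        rw [aff_inv] at this
        exact ⟨_, this⟩ }
  have hD : ∀ a : D, ∃ b, aff a.1 b ∈ G := fun a => a.2
  choose s hs using hD
  have : Finite D := Finite.of_injective (fun a : D => (⟨aff a.1 (s a), hs a⟩ : G)) (by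
    intro a b h
    have := congrArg Subtype.val h
    exact Subtype.ext (aff_inj.1 this).1)
  have hcyc : IsCyclic D := inferInstance
  obtain ⟨a0, ha0⟩ := hcyc.exists_generator
  have key : ∃ v : K, aff a0.1 0 ∈ cj (aff 1 v) G := by
    by_cases h : a0.1 = 1
    · refine ⟨0, ?_⟩
      rw [h, aff_one]; exact Subgroup.one_mem _
    · have h' : (a0.1 : K) - 1 ≠ 0 := by
        intro h2
        apply h
        apply Units.ext
        simpa [sub_eq_zero] using h2
      refine ⟨s a0 / ((a0.1 : K) - 1), ?_⟩
      rw [cj_trans]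
      have e : (a0.1 : K) * (s a0 / ((a0.1 : K) - 1)) + 0 - s a0 / ((a0.1 : K) - 1) = s a0 := by
        field_simp
        ring
      rw [e]; exact hs a0
  obtain ⟨v, hv⟩ := key
  refine ⟨v, fun a b hab => ?_⟩
  rw [cj_trans] at hab
  obtain ⟨k, hk⟩ := mem_powers_iff_mem_zpowers.2 (ha0 ⟨a, _, hab⟩)
  have h1 : a0.1 ^ k = a := congrArg Subtype.val hk
  have h2 := Subgroup.pow_mem _ hv k
  rwa [aff_pow, h1] at h2

lemma exists_to_inf (x : OnePoint K) : ∃ b : PGL2 K, b • x = ∞ := by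
  induction x using OnePoint.rec with
  | infty => exact ⟨1, one_smul _ _⟩
  | coe z =>
    obtain ⟨b, hb, _⟩ := exists_move (z : OnePoint K) ∞ (OnePoint.coe_ne_infty z)
    exact ⟨b, hb⟩

lemma borel (p : ℕ) [Fact p.Prime] [CharP K p] (G : Subgroup (PGL2 K)) [Finite G]
    (x : OnePoint K) (hfix : ∀ g ∈ G, g • x = x) : Concl p G := by
  obtain ⟨b, hb⟩ := exists_to_inf x
  obtain ⟨v, hv⟩ := norm0 (cj b G)
  refine (borel0 p (cj (aff 1 v) (cj b G)) ?_ hv).congr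
    ((cjEquiv b G).trans (cjEquiv (aff 1 v) _))
  have h2 : ∀ g ∈ cj b G, g • (∞ : OnePoint K) = ∞ := by
    rintro _ ⟨g, hg, rfl⟩
    rw [← hb]
    exact (conj_fix b g x).2 (hfix g hg)
  rintro _ ⟨g, hg, rfl⟩
  have := (conj_fix (aff 1 v) g ∞).2 (h2 g hg)
  rwa [aff_inf] at this

/-- elements fixing both `x,y`: cyclic -/
lemma tame_cyclic (L : Subgroup (PGL2 K)) [Finite L] (x y : OnePoint K) (hxy : x ≠ y)
    (h : ∀ g ∈ L, g • x = x ∧ g • y = y) : IsCyclic L := by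
  obtain ⟨b, hb1, hb2⟩ := exists_move x y hxy
  have key : ∀ g : L, ∃ a : Kˣ, b * g.1 * b⁻¹ = aff a 0 := by
    intro g
    have h1 := (conj_fix b g.1 x).2 (h g.1 g.2).1
    have h2 := (conj_fix b g.1 y).2 (h g.1 g.2).2
    rw [hb1] at h1
    rw [hb2] at h2
    obtain ⟨a, c, hac⟩ := exists_aff h1
    rw [hac, aff_coe] at h2
    have : c = 0 := by simpa using h2
    exact ⟨a, by rw [hac, this]⟩
  choose f hf using key
  let F : L →* Kˣ := MonoidHom.mk' f (by
    intro g h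
    have : aff (f (g * h)) 0 = aff (f g) 0 * aff (f h) 0 := by
      rw [← hf, ← hf, ← hf]; simp
    rw [aff_mul] at this
    exact (aff_inj.1 this).1)
  refine isCyclic_of_subgroup_isDomain ((Units.coeHom K).comp F) ?_
  intro g h hgh
  have h1 : f g = f h := Units.ext hgh
  have h2 : b * g.1 * b⁻¹ = b * h.1 * b⁻¹ := by rw [hf, hf, h1]
  exact Subtype.ext (by simpa using h2)

lemma orbit_sub {G : Subgroup (PGL2 K)} {x z : OnePoint K} {g : PGL2 K} (hg : g ∈ G)
    (hz : z ∈ MulAction.orbit G x) : g • z ∈ MulAction.orbit G x := by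
  obtain ⟨h, rfl⟩ := hz
  exact ⟨⟨g, hg⟩ * h, mul_smul g h.1 x⟩

lemma dih (G : Subgroup (PGL2 K)) [Finite G] (x : OnePoint K)
    (h : (MulAction.orbit G x).ncard = 2) : Nonempty (G ≃* DihedralGroup (e G x)) := by
  have hx : x ∈ MulAction.orbit G x := MulAction.mem_orbit_self x
  obtain ⟨y, hxy, hO⟩ : ∃ y, x ≠ y ∧ MulAction.orbit G x = {x, y} := by
    obtain ⟨a, b, hab, hO⟩ := Set.ncard_eq_two.1 h
    rw [hO] at hx
    rcases hx with rfl | hx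
    · exact ⟨b, hab, hO⟩
    · rw [Set.mem_singleton_iff] at hx
      subst hx
      exact ⟨a, hab.symm, by rw [hO, Set.pair_comm]⟩
  have hy : y ∈ MulAction.orbit G x := by rw [hO]; simp
  have hm : ∀ g ∈ G, ∀ z ∈ MulAction.orbit G x, g • z = x ∨ g • z = y := by
    intro g hg z hz
    have := orbit_sub hg hz
    rw [hO] at this
    simpa using this
  have hst : ∀ g ∈ st G x, g • x = x ∧ g • y = y := by
    intro g hg
    refine ⟨hg.2, ?_⟩
    rcases hm g hg.1 y hy with h1 | h1
    · exfalso
      apply hxy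
      have h2 : g • x = g • y := by rw [h1]; exact hg.2
      exact (MulAction.injective g) h2
    · exact h1
  have hc : IsCyclic (st G x) := tame_cyclic (st G x) x y hxy hst
  let C : Subgroup G := (st G x).subgroupOf G
  have hle : st G x ≤ G := fun g hg => hg.1
  let ε : C ≃* st G x := Subgroup.subgroupOfEquivOfLe hle
  have hcC : IsCyclic C := isCyclic_of_surjective ε.symm.toMonoidHom ε.symm.surjective
  have hcard : Nat.card C = e G x := Nat.card_congr ε.toEquiv
  have hidx : C.index = 2 := by
    have h1 := C.index_mul_card
    have h2 := orbit_mul_e G x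
    rw [h, ← hcard, ← h1] at h2
    exact (Nat.eq_of_mul_eq_mul_right Nat.card_pos h2).symm
  rw [← hcard]
  apply dihedral_abs C hidx
  intro g hg
  have hgx : g.1 • x ≠ x := fun h1 => hg (Subgroup.mem_subgroupOf.2 ⟨g.2, h1⟩)
  have h1 : g.1 • x = y := (hm g.1 g.2 x hx).resolve_left hgx
  have h2 : g.1 • y = x := by
    rcases hm g.1 g.2 y hy with h2 | h2
    · exact h2
    · exact absurd (MulAction.injective g.1 (h1.trans h2.symm)) hxy
  exact Subtype.ext (swap_sq hxy h1 h2)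

end borel
end Dick
namespace Dick

open OnePoint

section tame
variable {K : Type} [Field K]

lemma card2 {H : Type} [Group H] (L : Subgroup H) (h : Nat.card L = 2) :
    ∃ t ∈ L, t ≠ 1 ∧ t * t = 1 ∧ ∀ g ∈ L, g = 1 ∨ g = t := by
  obtain ⟨t, ht, hu⟩ := (Nat.card_eq_two_iff' (1 : L)).1 h
  have hu' : ∀ g ∈ L, g = 1 ∨ g = t := by
    intro g hg
    by_cases h1 : g = 1
    · exact Or.inl h1
    · right
      have := hu ⟨g, hg⟩ (fun h => h1 (congrArg Subtype.val h))
      exact congrArg Subtype.val this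
  have ht1 : t.1 ≠ 1 := fun h => ht (Subtype.ext h)
  refine ⟨t.1, t.2, ht1, ?_, hu'⟩
  rcases hu' _ (L.mul_mem t.2 t.2) with h | h
  · exact h
  · exact absurd (mul_eq_left.1 h) ht1

lemma a5' (G : Subgroup (PGL2 K)) [Finite G] (hG : Nat.card G = 60) (t₀ : PGL2 K) (hm : t₀ ∈ G)
    (h1 : t₀ ≠ 1) (h2 : t₀ * t₀ = 1) (x y : OnePoint K) (hxy : x ≠ y)
    (hfix : ∀ z : OnePoint K, t₀ • z = z ↔ z = x ∨ z = y)
    (hst : ∀ g ∈ G, g • x = x → g • y = y → g = 1 ∨ g = t₀)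
    (hconj : ∀ t ∈ G, t ≠ 1 → t * t = 1 → ∃ g ∈ G, t = g * t₀ * g⁻¹) :
    Nonempty (G ≃* alternatingGroup (Fin 5)) := by
  have hpres : ∀ g : PGL2 K, g * t₀ = t₀ * g → (g • x = x ∧ g • y = y) ∨ (g • x = y ∧ g • y = x) := by
    intro g hg
    have hx : g • x = x ∨ g • x = y := by
      rw [← hfix, ← mul_smul, ← hg, mul_smul, (hfix x).2 (Or.inl rfl)]
    have hy : g • y = x ∨ g • y = y := by
      rw [← hfix, ← mul_smul, ← hg, mul_smul, (hfix y).2 (Or.inr rfl)]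
    rcases hx with hx | hx <;> rcases hy with hy | hy
    · exact absurd (MulAction.injective g (hx.trans hy.symm)) hxy
    · exact Or.inl ⟨hx, hy⟩
    · exact Or.inr ⟨hx, hy⟩
    · exact absurd (MulAction.injective g (hx.trans hy.symm)) hxy
  refine a5_abs hG ⟨t₀, hm⟩ ?_ ?_ ?_ ?_
  · have : Fact (Nat.Prime 2) := ⟨Nat.prime_two⟩
    apply orderOf_eq_prime
    · rw [pow_two]; exact Subtype.ext h2
    · intro h; exact h1 (congrArg Subtype.val h)
  · intro t ht
    have ht1 : t.1 ≠ 1 := by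
      intro h
      have : t = 1 := Subtype.ext h
      rw [this] at ht; simp at ht
    have ht2 : t.1 * t.1 = 1 := by
      have := pow_orderOf_eq_one t
      rw [ht, pow_two] at this
      exact congrArg Subtype.val this
    obtain ⟨g, hg, h⟩ := hconj t.1 t.2 ht1 ht2
    exact ⟨⟨g, hg⟩, Subtype.ext h⟩
  · have key : ∃ s : G, ∀ g ∈ Subgroup.centralizer {(⟨t₀, hm⟩ : G)},
        g ∈ ({1, ⟨t₀, hm⟩, s, s * ⟨t₀, hm⟩} : Set G) := by
      by_cases hs : ∃ s : G, s.1 • x = y ∧ s.1 • y = x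
      · obtain ⟨s, hs1, hs2⟩ := hs
        refine ⟨s, fun g hg => ?_⟩
        rw [Subgroup.mem_centralizer_singleton_iff] at hg
        rcases hpres g.1 (congrArg Subtype.val hg) with h | h
        · rcases hst g.1 g.2 h.1 h.2 with h | h
          · left; exact Subtype.ext h
          · right; left; exact Subtype.ext h
        · have := hst (s⁻¹ * g).1 (s⁻¹ * g).2
            (by simp only [Subgroup.coe_mul, Subgroup.coe_inv]
                rw [mul_smul, h.1, inv_smul_eq_iff, hs1])
            (by simp only [Subgroup.coe_mul, Subgroup.coe_inv]
                rw [mul_smul, h.2, inv_smul_eq_iff, hs2])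
          rcases this with h | h
          · right; right; left
            have : s⁻¹ * g = 1 := Subtype.ext h
            exact (inv_mul_eq_one.1 this).symm
          · right; right; right
            have : s⁻¹ * g = ⟨t₀, hm⟩ := Subtype.ext h
            exact inv_mul_eq_iff_eq_mul.1 this
      · refine ⟨1, fun g hg => ?_⟩
        rw [Subgroup.mem_centralizer_singleton_iff] at hg
        rcases hpres g.1 (congrArg Subtype.val hg) with h | h
        · rcases hst g.1 g.2 h.1 h.2 with h | h
          · left; exact Subtype.ext h
          · right; left; exact Subtype.ext h
        · exact absurd ⟨g, h⟩ hs
    obtain ⟨s, hs⟩ := key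
    have h3 := Set.ncard_le_ncard (s := (Subgroup.centralizer {(⟨t₀, hm⟩ : G)} : Set G))
      (t := ({1, ⟨t₀, hm⟩, s, s * ⟨t₀, hm⟩} : Set G)) (fun g hg => hs g hg) (Set.toFinite _)
    have h4 : ({1, ⟨t₀, hm⟩, s, s * ⟨t₀, hm⟩} : Set G).ncard ≤ 4 := by
      classical
      have := Finset.card_le_four (a := (1 : G)) (b := ⟨t₀, hm⟩) (c := s) (d := s * ⟨t₀, hm⟩)
      rw [← Set.ncard_coe_finset] at this
      simpa using this
    exact h3.trans h4
  · intro w hw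
    have hw4 : (w.1 * w.1) * (w.1 * w.1) = 1 := by
      have := pow_orderOf_eq_one w
      rw [hw] at this
      have := congrArg Subtype.val this
      simp only [Subgroup.coe_pow, Subgroup.coe_one] at this
      rw [← this]; simp [pow_succ, mul_assoc]
    have hw2 : w.1 * w.1 ≠ 1 := by
      intro h
      have h' : w ^ 2 = 1 := by rw [pow_two]; exact Subtype.ext h
      have := orderOf_dvd_of_pow_eq_one h'
      rw [hw] at this
      omega
    obtain ⟨g, hg, h⟩ := hconj _ (G.mul_mem w.2 w.2) hw2 hw4
    set v := g⁻¹ * w.1 * g with hv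
    have hvG : v ∈ G := G.mul_mem (G.mul_mem (G.inv_mem hg) w.2) hg
    have hvt : v * v = t₀ := by
      have : v * v = g⁻¹ * (w.1 * w.1) * g := by rw [hv]; group
      rw [this, h]; group
    rcases hpres v (hvt ▸ (mul_assoc v v v).symm) with h3 | h3
    · rcases hst v hvG h3.1 h3.2 with h4 | h4
      · rw [h4, one_mul] at hvt; exact h1 hvt.symm
      · rw [h4, h2] at hvt; exact h1 hvt.symm
    · rw [swap_sq hxy h3.1 h3.2] at hvt
      exact h1 hvt.symm

lemma order_p_single (p : ℕ) [Fact p.Prime] [CharP K p] {g : PGL2 K} (hg : g ≠ 1) (hp : g ^ p = 1)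
    {x y : OnePoint K} (hx : g • x = x) (hy : g • y = y) : x = y := by
  by_contra hxy
  obtain ⟨b, hb1, hb2⟩ := exists_move x y hxy
  have h1 := (conj_fix b g x).2 hx
  have h2 := (conj_fix b g y).2 hy
  rw [hb1] at h1
  rw [hb2] at h2
  obtain ⟨a, c, hac⟩ := exists_aff h1
  rw [hac, aff_coe] at h2
  have hc : c = 0 := by simpa using h2
  subst hc
  have h3 : (b * g * b⁻¹) ^ p = 1 := by rw [conj_pow, hp]; simp
  rw [hac, aff_pow, ← aff_one, aff_inj] at h3
  have h4 : (a : K) ^ p = 1 := by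
    have := congrArg Units.val h3.1
    simpa using this
  have h5 : (a : K) = 1 := by
    have : ((a : K) - 1) ^ p = 0 := by
      rw [sub_pow_char, h4]; simp
    simpa [sub_eq_zero] using pow_eq_zero_iff (Fact.out : p.Prime).ne_zero |>.1 this
  have h6 : a = 1 := Units.ext h5
  rw [h6, aff_one] at hac
  apply hg
  have := mul_inv_eq_one.1 hac
  exact mul_eq_left.1 this

lemma u_eq_one {G : Subgroup (PGL2 K)} [Finite G] {x : OnePoint K} : u G x = 1 ↔ U G x = ∅ := by
  have hf : (U G x).Finite := (Set.toFinite (G : Set (PGL2 K))).subset (fun g hg => hg.1)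
  rw [u]
  constructor
  · intro h
    rw [← Set.ncard_eq_zero hf]; omega
  · intro h; rw [h]; simp

lemma orbit_faithful (G : Subgroup (PGL2 K)) (z : OnePoint K)
    (hn : 2 < (MulAction.orbit G z).ncard) :
    Function.Injective (MulAction.toPermHom G (MulAction.orbit G z)) := by
  rw [injective_iff_map_eq_one]
  intro g hg
  obtain ⟨a, b, c, ha, hb, hc, hab, hac, hbc⟩ :=
    (Set.two_lt_ncard_iff (Set.finite_of_ncard_pos (by omega))).1 hn
  have key : ∀ w, w ∈ MulAction.orbit G z → g.1 • w = w := by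
    intro w hw
    have := congrArg (fun σ => (σ ⟨w, hw⟩ : MulAction.orbit G z).1) hg
    exact this
  exact Subtype.ext (fix3 hab hac hbc (key a ha) (key b hb) (key c hc))

variable [IsAlgClosed K]

lemma tame_fix {G : Subgroup (PGL2 K)} [Finite G] (hT : ∀ x, u G x = 1) {g : PGL2 K} (hg : g ∈ G)
    (h1 : g ≠ 1) : ∃ a b, a ≠ b ∧ ∀ z : OnePoint K, g • z = z ↔ z = a ∨ z = b := by
  rcases fix_cases h1 with ⟨x, hx⟩ | ⟨x, y, hxy, h⟩
  · exfalso
    have h2 := u_eq_one.1 (hT x)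
    have : g ∈ U G x := ⟨hg, h1, fun y => by
      have : y ∈ {x : OnePoint K | g • x = x} ↔ y ∈ ({x} : Set (OnePoint K)) := by rw [hx]
      exact this⟩
    rw [h2] at this
    exact this
  · refine ⟨x, y, hxy, fun z => ?_⟩
    have : z ∈ {x : OnePoint K | g • x = x} ↔ z ∈ ({x, y} : Set (OnePoint K)) := by rw [h]
    exact this

lemma tame_not_dvd (p : ℕ) [hp : Fact p.Prime] [CharP K p] {G : Subgroup (PGL2 K)} [Finite G]
    (hT : ∀ x, u G x = 1) : ¬ p ∣ Nat.card G := by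
  intro h
  obtain ⟨g, hg⟩ := exists_prime_orderOf_dvd_card' p h
  have h1 : g.1 ≠ 1 := by
    intro h
    have : g = 1 := Subtype.ext h
    rw [this] at hg
    simp at hg
    exact hp.out.one_lt.ne hg
  obtain ⟨a, b, hab, hz⟩ := tame_fix hT g.2 h1
  refine hab (order_p_single p h1 ?_ ((hz a).2 (Or.inl rfl)) ((hz b).2 (Or.inr rfl)))
  have := pow_orderOf_eq_one g
  rw [hg] at this
  exact congrArg Subtype.val this

end tame
end Dick
namespace Dick

open OnePoint

section tame2
variable {K : Type} [Field K]

lemma order_dvd_e {G : Subgroup (PGL2 K)} {x : OnePoint K} {g : PGL2 K} (hg : g ∈ G)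
    (hx : g • x = x) : orderOf g ∣ e G x :=
  Subgroup.orderOf_dvd_natCard (st G x) ⟨hg, hx⟩

lemma ncard_pair_le2 {X : Type} (a b : X) : ({a, b} : Set X).ncard ≤ 2 := by
  by_cases h : a = b
  · subst h; simp
  · rw [Set.ncard_pair h]

variable [IsAlgClosed K]

lemma s4 (G : Subgroup (PGL2 K)) [Finite G] (hT : ∀ x, u G x = 1) (hG : Nat.card G = 24)
    (he : ∀ x, e G x ≤ 4) : Nonempty (G ≃* Equiv.Perm (Fin 4)) := by
  have h3p : Fact (Nat.Prime 3) := ⟨Nat.prime_three⟩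
  have hPcard : ∀ P : Sylow 3 G, Nat.card P = 3 := by
    intro P
    rw [P.card_eq_multiplicity, hG]
    have : Nat.factorization 24 3 = 1 := by
      rw [show 24 = 3 * 8 from rfl, Nat.factorization_mul (by norm_num) (by norm_num)]
      have : Nat.factorization 8 3 = 0 := Nat.factorization_eq_zero_of_not_dvd (by norm_num)
      simp [this, Nat.prime_three]
    rw [this]; rfl
  have hP : ∀ P : Sylow 3 G, ∃ a b : OnePoint K, a ≠ b ∧ (∀ g : G, g ∈ P ↔ g.1 • a = a) ∧
      (∀ g : G, g ∈ P ↔ g.1 • b = b) ∧ ∃ h ∈ P, ∀ z : OnePoint K, h.1 • z = z ↔ z = a ∨ z = b := by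
    intro P
    have : Nontrivial P := by
      rw [← Finite.one_lt_card_iff_nontrivial]
      exact lt_of_lt_of_eq (by norm_num : 1 < 3) (hPcard P).symm
    obtain ⟨h, h1⟩ := exists_ne (1 : P)
    have ho : orderOf h = 3 := orderOf_eq_prime (by
      have h3 := pow_card_eq_one' (x := h)
      exact (congrArg (fun n => h ^ n) (hPcard P)).symm.trans h3) h1
    have h1' : h.1.1 ≠ 1 := fun hh => h1 (Subtype.ext (Subtype.ext hh))
    have ho' : orderOf h.1.1 = 3 := by
      rw [Subgroup.orderOf_coe, Subgroup.orderOf_coe, ho]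
    obtain ⟨a, b, hab, hz⟩ := tame_fix hT h.1.2 h1'
    have key : ∀ a : OnePoint K, h.1.1 • a = a → ∀ g : G, g ∈ P ↔ g.1 • a = a := by
      intro a ha
      have hd := order_dvd_e h.1.2 ha
      rw [ho'] at hd
      have hpos := e_pos G a
      have h4 := he a
      have he3 : e G a = 3 := by omega
      let S : Subgroup G := (st G a).subgroupOf G
      have hle : st G a ≤ G := fun g hg => hg.1
      have hS : Nat.card S = 3 :=
        (Nat.card_congr (Subgroup.subgroupOfEquivOfLe hle).toEquiv).trans he3
      have hzS : Subgroup.zpowers h.1 = S := by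
        apply Subgroup.eq_of_le_of_card_ge
        · rw [Subgroup.zpowers_le]
          exact Subgroup.mem_subgroupOf.2 ⟨h.1.2, ha⟩
        · rw [hS, Nat.card_zpowers, Subgroup.orderOf_coe, ho]
      have hzP : Subgroup.zpowers h.1 = P.toSubgroup := by
        apply Subgroup.eq_of_le_of_card_ge
        · rw [Subgroup.zpowers_le]
          exact h.2
        · rw [Nat.card_zpowers, Subgroup.orderOf_coe, ho]
          exact (hPcard P).le
      intro g
      have : g ∈ P ↔ g ∈ S := by rw [← hzS, hzP]; rfl
      rw [this, Subgroup.mem_subgroupOf]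
      exact ⟨fun h => h.2, fun h => ⟨g.2, h⟩⟩
    exact ⟨a, b, hab, key a ((hz a).2 (Or.inl rfl)), key b ((hz b).2 (Or.inr rfl)), h.1, h.2, hz⟩
  choose a b hab ha hb hh using hP
  have hnorm : ∀ P : Sylow 3 G, ∀ g ∈ Subgroup.normalizer (P : Set G),
      (g.1 • a P = a P ∨ g.1 • a P = b P) ∧ (g.1 • b P = a P ∨ g.1 • b P = b P) := by
    intro P g hg
    obtain ⟨h, hhP, hz⟩ := hh P
    have h1 : g⁻¹ * h * g ∈ P := by
      have := (Subgroup.mem_normalizer_iff.1 (Subgroup.inv_mem _ hg) h).1 hhP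
      rw [inv_inv] at this
      exact this
    have key : ∀ w : OnePoint K, (g⁻¹ * h * g).1 • w = w → h.1 • (g.1 • w) = g.1 • w := by
      intro w hw
      simp only [Subgroup.coe_mul, Subgroup.coe_inv] at hw
      rwa [mul_smul, mul_smul, inv_smul_eq_iff] at hw
    exact ⟨(hz _).1 (key _ ((ha P _).1 h1)), (hz _).1 (key _ ((hb P _).1 h1))⟩
  have hNcard : ∀ P : Sylow 3 G, Nat.card (Subgroup.normalizer (P : Set G)) ≤ 6 := by
    intro P
    let N' : Subgroup (PGL2 K) := (Subgroup.normalizer (P : Set G)).map G.subtype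
    have hN'G : N' ≤ G := by
      rintro _ ⟨g, _, rfl⟩; exact g.2
    have hc : Nat.card (Subgroup.normalizer (P : Set G)) = Nat.card N' :=
      Nat.card_congr ((Subgroup.normalizer (P : Set G)).equivMapOfInjective _
        G.subtype_injective).toEquiv
    rw [hc, ← orbit_mul_e N' (a P)]
    have h1 : (MulAction.orbit N' (a P)).ncard ≤ 2 := by
      refine (Set.ncard_le_ncard (t := {a P, b P}) ?_ (Set.toFinite _)).trans
        (ncard_pair_le2 _ _)
      rintro _ ⟨⟨_, ⟨g, hg, rfl⟩⟩, rfl⟩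
      exact (hnorm P g hg).1
    have h2 : e N' (a P) ≤ 3 := by
      rw [← hPcard P]
      refine Nat.card_le_card_of_injective
        (fun g : st N' (a P) => (⟨⟨g.1, hN'G g.2.1⟩, (ha P _).2 g.2.2⟩ : P)) ?_
      intro g h hgh
      exact Subtype.ext (congrArg (fun x : P => x.1.1) hgh)
    calc _ ≤ 2 * 3 := Nat.mul_le_mul h1 h2
      _ = 6 := rfl
  have hn3 : Nat.card (Sylow 3 G) = 4 := by
    obtain ⟨P⟩ : Nonempty (Sylow 3 G) := inferInstance
    have h2 := P.card_eq_index_normalizer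
    have h3 := (Subgroup.normalizer (P : Set G)).index_mul_card
    rw [← h2, hG] at h3
    have h4 := hNcard P
    have h5 : Nat.card (Sylow 3 G) ≡ 1 [MOD 3] := card_sylow_modEq_one 3 G
    have h6 := P.card_dvd_index
    have h7 : P.index = 8 := by
      have := P.toSubgroup.index_mul_card
      have h8 : Nat.card P.toSubgroup = 3 := hPcard P
      rw [h8, hG] at this
      have h9 : P.toSubgroup.index = 8 := by omega
      exact h9
    rw [h7] at h6
    generalize Nat.card (Sylow 3 G) = m at *
    have h8 : 4 ≤ m := by
      by_contra hlt
      have : m ≤ 3 := by omega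
      have := Nat.mul_le_mul this h4
      omega
    have h9 := Nat.le_of_dvd (by norm_num) h6
    unfold Nat.ModEq at h5
    interval_cases m <;> omega
  have hinj : Function.Injective (MulAction.toPermHom G (Sylow 3 G)) := by
    rw [injective_iff_map_eq_one]
    intro n₁ hn₁
    set N := (MulAction.toPermHom G (Sylow 3 G)).ker with hN
    have hn₁N : n₁ ∈ N := hn₁
    have hNP : ∀ g ∈ N, ∀ P : Sylow 3 G, g ∈ Subgroup.normalizer (P : Set G) := by
      intro g hg P
      have h1 : MulAction.toPermHom G (Sylow 3 G) g = 1 := hg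
      have h2 : g • P = P := by
        have := congrArg (fun σ => σ P) h1
        simpa using this
      exact Sylow.smul_eq_iff_mem_normalizer.1 h2
    have hsw : ∀ g ∈ N, ∀ P, (g.1 • a P = a P ∧ g.1 • b P = b P) ∨
        (g.1 • a P = b P ∧ g.1 • b P = a P) := by
      intro g hg P
      obtain ⟨hx, hy⟩ := hnorm P g (hNP g hg P)
      rcases hx with hx | hx <;> rcases hy with hy | hy
      · exact absurd (MulAction.injective g.1 (hx.trans hy.symm)) (hab P)
      · exact Or.inl ⟨hx, hy⟩
      · exact Or.inr ⟨hx, hy⟩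
      · exact absurd (MulAction.injective g.1 (hx.trans hy.symm)) (hab P)
    have hsq : ∀ g ∈ N, g * g = 1 := by
      intro g hg
      have h1 : ∀ P, (g.1 * g.1) • a P = a P ∧ (g.1 * g.1) • b P = b P := by
        intro P
        rw [mul_smul, mul_smul]
        rcases hsw g hg P with h | h
        · rw [h.1, h.2]; exact h
        · rw [h.1, h.2]; exact ⟨rfl, h.1⟩
      have : Nontrivial (Sylow 3 G) := by
        rw [← Finite.one_lt_card_iff_nontrivial, hn3]; norm_num
      obtain ⟨P, Q, hPQ⟩ := exists_pair_ne (Sylow 3 G)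
      have h2 : a P ≠ a Q := by
        intro h
        apply hPQ
        apply Sylow.ext
        ext g
        have := (ha P g)
        rw [h, ← ha Q g] at this
        exact this
      have h3 : b P ≠ a Q := by
        intro h
        apply hPQ
        apply Sylow.ext
        ext g
        have := (hb P g)
        rw [h, ← ha Q g] at this
        exact this
      exact Subtype.ext (fix3 (hab P) h2 h3 (h1 P).1 (h1 P).2 (h1 Q).1)
    have hno : ∀ g ∈ N, ∀ P : Sylow 3 G, g ∈ P → g = 1 := by
      intro g hg P hgP
      have h1 : orderOf g ∣ 2 := orderOf_dvd_of_pow_eq_one (by rw [pow_two]; exact hsq g hg)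
      have h2 : orderOf g ∣ 3 := by
        have := Subgroup.orderOf_dvd_natCard P.toSubgroup hgP
        have h8 : Nat.card P.toSubgroup = 3 := hPcard P
        rwa [h8] at this
      have := Nat.dvd_gcd h1 h2
      rw [← orderOf_eq_one_iff]
      simpa using this
    by_contra hne
    obtain ⟨P⟩ : Nonempty (Sylow 3 G) := inferInstance
    have huniq : ∀ g ∈ N, g ≠ 1 → g = n₁ := by
      intro g hg hg1
      have f1 : ∀ g ∈ N, g ≠ 1 → g.1 • a P = b P := by
        intro g hg hg1
        rcases hsw g hg P with h | h
        · exact absurd (hno g hg P ((ha P g).2 h.1)) hg1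
        · exact h.1
      have h1 : (g⁻¹ * n₁).1 • a P = a P := by
        simp only [Subgroup.coe_mul, Subgroup.coe_inv]
        rw [mul_smul, f1 n₁ hn₁N hne, inv_smul_eq_iff, f1 g hg hg1]
      have := hno (g⁻¹ * n₁) (N.mul_mem (N.inv_mem hg) hn₁N) P ((ha P _).2 h1)
      exact inv_mul_eq_one.1 this
    have hcen : ∀ c : G, c * n₁ * c⁻¹ = n₁ := by
      intro c
      apply huniq
      · exact (inferInstance : N.Normal).conj_mem _ hn₁N c
      · intro h
        apply hne
        simpa using h
    obtain ⟨x, y, hxy, hz⟩ := tame_fix hT n₁.2 (fun h => hne (Subtype.ext h))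
    have h1 : (MulAction.orbit G x).ncard ≤ 2 := by
      refine (Set.ncard_le_ncard (t := {x, y}) ?_ (Set.toFinite _)).trans
        (ncard_pair_le2 _ _)
      rintro _ ⟨c, rfl⟩
      have : n₁.1 • (c.1 • x) = c.1 • x := by
        conv_lhs => rw [← hcen c]
        simp only [Subgroup.coe_mul, Subgroup.coe_inv]
        rw [mul_smul, inv_smul_smul, mul_smul, (hz x).2 (Or.inl rfl)]
      exact (hz _).1 this
    have h2 := orbit_mul_e G x
    have h3 := Nat.mul_le_mul h1 (he x)
    omega
  exact emb_full _ hinj 4 hn3 (by rw [hG]; rfl)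

end tame2
end Dick
namespace Dick

open OnePoint

section tame3
variable {K : Type} [Field K]

lemma fixes_of_e {G : Subgroup (PGL2 K)} [Finite G] {x : OnePoint K} (h : e G x = Nat.card G) :
    ∀ g ∈ G, g • x = x := by
  have hle : st G x ≤ G := fun g hg => hg.1
  have : st G x = G := Subgroup.eq_of_le_of_card_ge hle (by rw [← h]; rfl)
  intro g hg
  rw [← this] at hg
  exact hg.2

lemma e_le (G : Subgroup (PGL2 K)) [Finite G] (x : OnePoint K) : e G x ≤ Nat.card G :=
  Nat.le_of_dvd Nat.card_pos (e_dvd G x)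

lemma arith3 (a b c g : ℕ) (ha : 2 ≤ a) (hab : a ≤ b) (hbc : b ≤ c) (hg : 0 < g)
    (h : (1 : ℚ) / a + 1 / b + 1 / c = 1 + 2 / g) :
    a = 2 ∧ ((b = 2 ∧ g = 2 * c) ∨ (b = 3 ∧ ((c = 3 ∧ g = 12) ∨ (c = 4 ∧ g = 24) ∨
      (c = 5 ∧ g = 60)))) := by
  have hgq : (0 : ℚ) < g := by exact_mod_cast hg
  have hpos : (0 : ℚ) < 2 / g := by positivity
  have mono : ∀ m n : ℕ, 0 < m → m ≤ n → (1 : ℚ) / n ≤ 1 / m := by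
    intro m n hm hmn
    apply one_div_le_one_div_of_le
    · exact_mod_cast hm
    · exact_mod_cast hmn
  have ha2 : a = 2 := by
    by_contra hne
    have h1 := mono 3 a (by norm_num) (by omega)
    have h2 := mono 3 b (by norm_num) (by omega)
    have h3 := mono 3 c (by norm_num) (by omega)
    norm_num at h1 h2 h3 h
    linarith
  subst ha2
  refine ⟨rfl, ?_⟩
  have hb4 : b < 4 := by
    by_contra hne
    have h2 := mono 4 b (by norm_num) (by omega)
    have h3 := mono 4 c (by norm_num) (by omega)
    norm_num at h2 h3 h
    linarith
  have hc0 : (0 : ℚ) < c := by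
    have : 0 < c := by omega
    exact_mod_cast this
  interval_cases b
  · left
    refine ⟨rfl, ?_⟩
    have h1 : (1 : ℚ) / c = 2 / g := by
      push_cast at h; linarith
    rw [div_eq_div_iff hc0.ne' hgq.ne'] at h1
    have : (g : ℚ) = 2 * c := by linarith
    exact_mod_cast this
  · right
    refine ⟨rfl, ?_⟩
    have hc6 : c < 6 := by
      by_contra hne
      have h3 := mono 6 c (by norm_num) (by omega)
      norm_num at h3 h
      linarith
    have h1 : (1 : ℚ) / c = 1 / 6 + 2 / g := by
      push_cast at h; linarith
    rw [div_add_div _ _ (by norm_num) hgq.ne', div_eq_div_iff hc0.ne' (by positivity)] at h1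
    have h2 : 6 * g = g * c + 12 * c := by
      have : (6 : ℚ) * g = g * c + 12 * c := by linarith
      exact_mod_cast this
    interval_cases c <;> omega

variable [IsAlgClosed K]

lemma tame3 (p : ℕ) [Fact p.Prime] [CharP K p] (G : Subgroup (PGL2 K)) [Finite G]
    (hT : ∀ x, u G x = 1) (x y z : OnePoint K)
    (hR : ∀ w, 2 ≤ e G w → w ∈ MulAction.orbit G x ∨ w ∈ MulAction.orbit G y ∨
      w ∈ MulAction.orbit G z) (hx : 2 ≤ e G x) (hxy : e G x ≤ e G y) (hyz : e G y ≤ e G z)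
    (h : (1 : ℚ) / e G x + 1 / e G y + 1 / e G z = 1 + 2 / Nat.card G) : Concl p G := by
  have hval : ∀ w, e G w ≤ 1 ∨ (e G w = e G x ∧ w ∈ MulAction.orbit G x) ∨
      e G w = e G y ∨ e G w = e G z := by
    intro w
    by_cases h2 : 2 ≤ e G w
    · right
      rcases hR w h2 with h | h | h
      · exact Or.inl ⟨e_orbit h, h⟩
      · exact Or.inr (Or.inl (e_orbit h))
      · exact Or.inr (Or.inr (e_orbit h))
    · left; omega
  obtain ⟨hx2, h⟩ := arith3 _ _ _ _ hx hxy hyz Nat.card_pos h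
  have hoz := orbit_mul_e G z
  have hzpos := e_pos G z
  rcases h with ⟨hy, hg⟩ | ⟨hy, ⟨hz, hg⟩ | ⟨hz, hg⟩ | ⟨hz, hg⟩⟩
  · rw [hg] at hoz
    have h2 := Nat.eq_of_mul_eq_mul_right hzpos hoz
    refine Or.inr (Or.inl ⟨e G z, ?_, dih G z h2⟩)
    intro hd
    exact tame_not_dvd p hT (hd.trans (e_dvd G z))
  · right; right; left
    rw [hg, hz] at hoz
    have h4 : (MulAction.orbit G z).ncard = 4 := by omega
    have : Finite (MulAction.orbit G z) := Set.finite_of_ncard_pos (by omega)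
    exact emb_alt _ (orbit_faithful G z (by omega)) 4 (by norm_num) h4 (by rw [hg]; rfl)
  · right; right; right; left
    refine s4 G hT hg (fun w => ?_)
    rcases hval w with h | ⟨h, _⟩ | h | h <;> omega
  · right; right; right; right; left
    obtain ⟨t, htm, ht1, ht2, htu⟩ := card2 (st G x) hx2
    have hfixx : ∀ {w : OnePoint K} {s : PGL2 K}, s ∈ G → s ≠ 1 → s * s = 1 → s • w = w →
        w ∈ MulAction.orbit G x := by
      intro w s hs hs1 hs2 hw
      have : Fact (Nat.Prime 2) := ⟨Nat.prime_two⟩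
      have ho : orderOf s = 2 := orderOf_eq_prime (by rw [pow_two, hs2]) hs1
      have hd := order_dvd_e hs hw
      have hpos := e_pos G w
      rw [ho] at hd
      rcases hval w with h | ⟨h, h'⟩ | h | h
      · omega
      · exact h'
      · omega
      · omega
    obtain ⟨a, b, hab, hz'⟩ := tame_fix hT htm.1 ht1
    have hex : ∃ y, x ≠ y ∧ ∀ z : OnePoint K, t • z = z ↔ z = x ∨ z = y := by
      rcases (hz' x).1 htm.2 with h | h
      · exact ⟨b, h ▸ hab, h ▸ hz'⟩
      · refine ⟨a, h ▸ hab.symm, ?_⟩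
        intro w; rw [hz' w, h, or_comm]
    obtain ⟨y', hxy', hfix⟩ := hex
    refine a5' G hg t htm.1 ht1 ht2 x y' hxy' hfix ?_ ?_
    · intro g hg hgx _
      exact htu g ⟨hg, hgx⟩
    · intro s hs hs1 hs2
      obtain ⟨w, hw⟩ := exists_fix s
      obtain ⟨g, rfl⟩ := hfixx hs hs1 hs2 hw
      have hw' : s • (g.1 • x) = g.1 • x := hw
      refine ⟨g.1, g.2, ?_⟩
      have h1 : g.1⁻¹ * s * g.1 ∈ st G x := by
        refine ⟨G.mul_mem (G.mul_mem (G.inv_mem g.2) hs) g.2, ?_⟩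
        change (g.1⁻¹ * s * g.1) • x = x
        rw [mul_smul, mul_smul, hw', inv_smul_smul]
      rcases htu _ h1 with h2 | h2
      · exfalso
        apply hs1
        have : s = g.1 * (g.1⁻¹ * s * g.1) * g.1⁻¹ := by group
        rw [this, h2]; group
      · rw [← h2]; group

theorem tame (p : ℕ) [Fact p.Prime] [CharP K p] (G : Subgroup (PGL2 K)) [Finite G]
    (hT : ∀ x, u G x = 1) : Concl p G := by
  classical
  obtain ⟨R, h2, hne, hR, hs⟩ := count G
  have hgpos : 0 < Nat.card G := Nat.card_pos
  have hgq : (0 : ℚ) < Nat.card G := by exact_mod_cast hgpos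
  have hterm : ∀ x ∈ R, ((e G x : ℚ) + u G x - 2) / e G x = 1 - 1 / e G x := by
    intro x hx
    have : (e G x : ℚ) ≠ 0 := by
      have := h2 x hx
      have : e G x ≠ 0 := by omega
      exact_mod_cast this
    rw [hT x]
    field_simp
    push_cast
    ring
  rw [Finset.sum_congr rfl hterm] at hs
  have hcard : R.card < 4 := by
    by_contra hlt
    have h1 : ∀ x ∈ R, (1 / 2 : ℚ) ≤ 1 - 1 / e G x := by
      intro x hx
      have h3 := h2 x hx
      have h4 : (2 : ℚ) ≤ e G x := by exact_mod_cast h3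
      have : (1 : ℚ) / e G x ≤ 1 / 2 := one_div_le_one_div_of_le (by norm_num) h4
      linarith
    have h3 := Finset.card_nsmul_le_sum R _ _ h1
    rw [hs, nsmul_eq_mul] at h3
    have h4 : (4 : ℚ) ≤ R.card := by
      have : 4 ≤ R.card := by omega
      exact_mod_cast this
    have : (0 : ℚ) < 2 / Nat.card G := by positivity
    linarith
  have hle : ∀ x ∈ R, (1 : ℚ) / Nat.card G ≤ 1 / e G x := by
    intro x hx
    have := h2 x hx
    apply one_div_le_one_div_of_le
    · have : 0 < e G x := by omega
      exact_mod_cast this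
    · exact_mod_cast e_le G x
  have h2g : (2 : ℚ) / Nat.card G = 2 * (1 / Nat.card G) := by ring
  rw [h2g] at hs
  have hinv : ∀ x ∈ R, (1 : ℚ) / e G x = 1 / Nat.card G → e G x = Nat.card G := by
    intro x hx h
    rw [one_div, one_div, inv_inj] at h
    exact_mod_cast h
  interval_cases hc : R.card
  · rw [Finset.card_eq_zero.1 hc, Finset.sum_empty] at hs
    have h1 : (1 : ℚ) / Nat.card G = 1 := by linarith
    rw [one_div, inv_eq_one] at h1
    have h1' : Nat.card G = 1 := by exact_mod_cast h1
    have hb : G = ⊥ := Subgroup.card_eq_one.1 h1'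
    apply borel p G ∞
    intro g hg
    rw [hb, Subgroup.mem_bot] at hg
    rw [hg, one_smul]
  · obtain ⟨x, rfl⟩ := Finset.card_eq_one.1 hc
    rw [Finset.sum_singleton] at hs
    have h1 := hle x (by simp)
    have h3 := h2 x (by simp)
    have h5 : (2 : ℚ) ≤ Nat.card G := by exact_mod_cast h3.trans (e_le G x)
    have h6 : (1 : ℚ) / Nat.card G ≤ 1 / 2 := one_div_le_one_div_of_le (by norm_num) h5
    linarith
  · obtain ⟨x, y, hxy, rfl⟩ := Finset.card_eq_two.1 hc
    rw [Finset.sum_pair hxy] at hs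
    have h1 := hle x (by simp)
    have h3 := hle y (by simp)
    exact borel p G x (fixes_of_e (hinv x (by simp) (by linarith)))
  · obtain ⟨x, y, z, hxy, hxz, hyz, rfl⟩ := Finset.card_eq_three.1 hc
    rw [Finset.sum_insert (by simp [hxy, hxz]), Finset.sum_pair hyz] at hs
    have hx2 := h2 x (by simp)
    have hy2 := h2 y (by simp)
    have hz2 := h2 z (by simp)
    have hR' : ∀ w, 2 ≤ e G w → w ∈ MulAction.orbit G x ∨ w ∈ MulAction.orbit G y ∨
        w ∈ MulAction.orbit G z := by
      intro w hw
      obtain ⟨v, hv, hwv⟩ := hR w hw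
      simp only [Finset.mem_insert, Finset.mem_singleton] at hv
      rcases hv with rfl | rfl | rfl <;> simp [hwv]
    rcases le_total (e G x) (e G y) with h1 | h1 <;>
    rcases le_total (e G y) (e G z) with h3 | h3 <;>
    rcases le_total (e G x) (e G z) with h4 | h4
    · exact tame3 p G hT x y z (fun w hw => by have := hR' w hw; tauto) hx2 h1 h3 (by linarith)
    · exact tame3 p G hT x y z (fun w hw => by have := hR' w hw; tauto) hx2 h1 h3 (by linarith)
    · exact tame3 p G hT x z y (fun w hw => by have := hR' w hw; tauto) hx2 h4 h3 (by linarith)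
    · exact tame3 p G hT z x y (fun w hw => by have := hR' w hw; tauto) hz2 h4 h1 (by linarith)
    · exact tame3 p G hT y x z (fun w hw => by have := hR' w hw; tauto) hy2 h1 h4 (by linarith)
    · exact tame3 p G hT y z x (fun w hw => by have := hR' w hw; tauto) hy2 h3 h4 (by linarith)
    · exact tame3 p G hT z y x (fun w hw => by have := hR' w hw; tauto) hz2 h3 h1 (by linarith)
    · exact tame3 p G hT z y x (fun w hw => by have := hR' w hw; tauto) hz2 h3 h1 (by linarith)

end tame3
end Dick
namespace Dick

open OnePoint

section wild
variable {K : Type} [Field K]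

/-- translations as a subgroup -/
def tL (G : Subgroup (PGL2 K)) : Subgroup (PGL2 K) where
  carrier := {g | ∃ b ∈ tA G, g = aff 1 b}
  one_mem' := ⟨0, (tA G).zero_mem, aff_one.symm⟩
  mul_mem' := by
    rintro _ _ ⟨b, hb, rfl⟩ ⟨c, hc, rfl⟩
    exact ⟨c + b, (tA G).add_mem hc hb, by rw [aff_mul]; simp⟩
  inv_mem' := by
    rintro _ ⟨b, hb, rfl⟩
    exact ⟨-b, (tA G).neg_mem hb, by rw [aff_inv]; simp⟩

lemma card_tL (G : Subgroup (PGL2 K)) : Nat.card (tL G) = Nat.card (tA G) := by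
  symm
  refine Nat.card_congr (Equiv.ofBijective
    (fun b : tA G => (⟨aff 1 b.1, b.1, b.2, rfl⟩ : tL G)) ⟨?_, ?_⟩)
  · intro a b h
    exact Subtype.ext (aff_inj.1 (congrArg Subtype.val h)).2
  · rintro ⟨_, b, hb, rfl⟩
    exact ⟨⟨b, hb⟩, rfl⟩

lemma st_inf {G : Subgroup (PGL2 K)} (hN : ∀ a b, aff a b ∈ G → aff a 0 ∈ G) {g : PGL2 K}
    (hg : g ∈ st G ∞) : ∃ a ∈ tD G, ∃ b ∈ tA G, g = aff a b := by
  obtain ⟨a, b, rfl⟩ := exists_aff hg.2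
  have ha : a ∈ tD G := hN a b hg.1
  have hb : b ∈ tA G := by
    have := G.mul_mem hg.1 (G.inv_mem ha)
    rw [aff_inv, aff_mul] at this
    rw [mem_tA]; simpa using this
  exact ⟨a, ha, b, hb, rfl⟩

lemma aff_mem {G : Subgroup (PGL2 K)} {a : Kˣ} {b : K} (ha : a ∈ tD G) (hb : b ∈ tA G) :
    aff a b ∈ G := by
  have := G.mul_mem hb ha
  rw [aff_mul] at this
  simpa using this

lemma e_inf {G : Subgroup (PGL2 K)} (hN : ∀ a b, aff a b ∈ G → aff a 0 ∈ G) :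
    e G ∞ = Nat.card (tA G) * Nat.card (tD G) := by
  rw [← Nat.card_prod, e]
  symm
  refine Nat.card_congr (Equiv.ofBijective
    (fun x : tA G × tD G => (⟨aff x.2.1 x.1.1, aff_mem x.2.2 x.1.2, aff_inf _ _⟩ : st G ∞))
    ⟨?_, ?_⟩)
  · intro x y h
    have := aff_inj.1 (congrArg Subtype.val h)
    exact Prod.ext (Subtype.ext this.2) (Subtype.ext this.1)
  · rintro ⟨g, hg⟩
    obtain ⟨a, ha, b, hb, rfl⟩ := st_inf hN hg
    exact ⟨⟨⟨b, hb⟩, ⟨a, ha⟩⟩, rfl⟩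

lemma u_inf (G : Subgroup (PGL2 K)) [Finite G] : u G ∞ = Nat.card (tA G) := by
  have h : U G ∞ = (fun b => aff 1 b) '' ((tA G : Set K) \ {0}) := by
    ext g
    constructor
    · rintro ⟨hg, h1, hf⟩
      obtain ⟨a, b, rfl⟩ := exists_aff ((hf ∞).2 rfl)
      have ha : a = 1 := by
        by_contra hne
        have hne' : (1 : K) - a ≠ 0 := by
          intro h
          apply hne
          apply Units.ext
          rw [sub_eq_zero] at h
          exact h.symm
        have := (hf ((b / (1 - a) : K) : OnePoint K)).1 (by
          rw [aff_coe]
          congr 1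
          field_simp
          ring)
        exact OnePoint.coe_ne_infty _ this
      subst ha
      refine ⟨b, ⟨hg, ?_⟩, rfl⟩
      intro hb
      rw [Set.mem_singleton_iff.1 hb, aff_one] at h1
      exact h1 rfl
    · rintro ⟨b, ⟨hb, hb0⟩, rfl⟩
      refine ⟨hb, ?_, ?_⟩
      · intro h
        rw [← aff_one] at h
        exact hb0 (aff_inj.1 h).2
      · intro y
        constructor
        · intro hy
          induction y using OnePoint.rec with
          | infty => rfl
          | coe z =>
            exfalso
            apply hb0
            simpa using hy
        · rintro rfl; exact aff_inf _ _
  rw [u, h, Set.ncard_image_of_injective _ (fun a b h => (aff_inj.1 h).2),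
    Set.ncard_sdiff_singleton_of_mem (tA G).zero_mem]
  have : 0 < Nat.card (tA G) := Nat.card_pos
  have h2 : (tA G : Set K).ncard = Nat.card (tA G) := rfl
  omega

lemma one_sub_div {G : Subgroup (PGL2 K)} [Finite G] {a : Kˣ} (ha : a ∈ tD G) (h1 : a ≠ 1) {b : K}
    (hb : b ∈ tA G) : ∃ c ∈ tA G, c - a * c = b := by
  let f : tA G → tA G := fun c => ⟨c.1 - a * c.1, (tA G).sub_mem c.2 (tD_mul_tA ha c.2)⟩
  have hf : Function.Injective f := by
    intro c d h
    have h2 : c.1 - a * c.1 = d.1 - a * d.1 := congrArg Subtype.val h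
    have h3 : (1 - (a : K)) * (c.1 - d.1) = 0 := by linear_combination h2
    rcases mul_eq_zero.1 h3 with h | h
    · exfalso; apply h1; apply Units.ext
      rw [sub_eq_zero] at h; exact h.symm
    · exact Subtype.ext (sub_eq_zero.1 h)
  obtain ⟨c, hc⟩ := Finite.surjective_of_injective hf ⟨b, hb⟩
  exact ⟨c.1, c.2, congrArg Subtype.val hc⟩

lemma wild_arith (q n s e : ℕ) (hq : 2 ≤ q) (hn : 1 ≤ n) (hs : 1 ≤ s) (h1 : n ∣ q - 1)
    (h2 : n ∣ s - 1) (h : n * (1 + q * s) = e * (1 + (q - 2) * s)) :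
    (q = 2 ∧ n = 1 ∧ e = 1 + 2 * s) ∨ (s = 1 ∧ q - 1 ≤ 2 * n) ∨
    (q = 3 ∧ n = 2 ∧ s = 3 ∧ e = 5) := by
  obtain ⟨r, rfl⟩ : ∃ r, q = r + 2 := ⟨q - 2, by omega⟩
  have hr : r + 2 - 2 = r := by omega
  rw [hr] at h
  rcases Nat.eq_zero_or_pos r with rfl | hr0
  · left
    have : n = 1 := Nat.dvd_one.1 h1
    subst this
    refine ⟨rfl, rfl, ?_⟩
    simp at h; exact h.symm
  right
  have hdvd : (1 + r * s) ∣ 2 * n := by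
    have h3 : (1 + r * s) ∣ (2 * n) * s := by
      have e1 : (1 + r * s) ∣ n * (1 + r * s) := Dvd.intro_left _ rfl
      have e2 : (1 + r * s) ∣ n * (1 + r * s) + (2 * n) * s :=
        ⟨e, by rw [mul_comm _ e, ← h]; ring⟩
      exact (Nat.dvd_add_right e1).1 e2
    refine Nat.Coprime.dvd_of_dvd_mul_right ?_ h3
    rw [Nat.coprime_add_mul_right_left]; exact Nat.coprime_one_left s
  have hle := Nat.le_of_dvd (by omega) hdvd
  have hnr : n ≤ r + 1 := Nat.le_of_dvd (by omega) h1
  obtain ⟨k, hk⟩ := h2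
  have hsk : s = 1 + n * k := by omega
  rcases Nat.eq_zero_or_pos k with rfl | hk0
  · left
    have : s = 1 := by simpa using hsk
    subst this
    refine ⟨rfl, ?_⟩
    simp at hle; omega
  · right
    have hs1 : 1 + n ≤ s := by
      have : n * 1 ≤ n * k := Nat.mul_le_mul_left n hk0
      omega
    have hr1 : r = 1 := by
      by_contra hne
      have : 2 * (1 + n) ≤ r * s := Nat.mul_le_mul (by omega) hs1
      omega
    subst hr1
    have hn2 : n = 2 := by
      have : n ≤ 2 := hnr
      interval_cases n <;> omega
    subst hn2
    have hs3 : s = 3 := by omega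
    subst hs3
    refine ⟨rfl, rfl, rfl, ?_⟩
    omega

variable [IsAlgClosed K]

lemma wild_count (G : Subgroup (PGL2 K)) [Finite G] (h1A : (1 : K) ∈ tA G)
    (hN : ∀ a b, aff a b ∈ G → aff a 0 ∈ G) (hnf : ∃ g ∈ G, g • (∞ : OnePoint K) ≠ ∞)
    (h0 : tD G = ⊥ → ((0 : K) : OnePoint K) ∈ MulAction.orbit G (∞ : OnePoint K)) :
    ∃ (y : OnePoint K) (s : ℕ), 1 ≤ s ∧
      (MulAction.orbit G (∞ : OnePoint K)).ncard = 1 + Nat.card (tA G) * s ∧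
      Nat.card (tD G) * (1 + Nat.card (tA G) * s) = e G y * (1 + (Nat.card (tA G) - 2) * s) ∧
      Nat.card (tD G) ∣ s - 1 ∧
      (∀ w, 2 ≤ e G w → w ∈ MulAction.orbit G (∞ : OnePoint K) ∨ w ∈ MulAction.orbit G y) ∧
      (∀ b ∈ tA G, (b : OnePoint K) ∈ MulAction.orbit G (∞ : OnePoint K)) := by
  classical
  set q := Nat.card (tA G) with hqdef
  set n := Nat.card (tD G) with hndef
  set O := MulAction.orbit G (∞ : OnePoint K) with hO
  have hinfO : (∞ : OnePoint K) ∈ O := MulAction.mem_orbit_self _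
  have hq : 2 ≤ q := by
    have : Nontrivial (tA G) := ⟨⟨⟨0, (tA G).zero_mem⟩, ⟨1, h1A⟩, fun h =>
      zero_ne_one (congrArg Subtype.val h)⟩⟩
    exact Finite.one_lt_card
  have hn : 1 ≤ n := Nat.card_pos
  have heinf : e G ∞ = q * n := e_inf hN
  have huinf : u G ∞ = q := u_inf G
  have hOfin : O.Finite := Set.finite_range _
  -- the size of the orbit
  obtain ⟨s, hs1, hm⟩ : ∃ s, 1 ≤ s ∧ O.ncard = 1 + q * s := by
    have h := free_dvd (tL G) (O \ {(∞ : OnePoint K)}) (by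
      rintro _ ⟨b, hb, rfl⟩ x hx
      refine ⟨orbit_sub hb hx.1, ?_⟩
      intro h
      apply hx.2
      have h' : aff 1 b • x = aff 1 b • (∞ : OnePoint K) := by
        rw [aff_inf]; exact h
      exact MulAction.injective _ h') (by
      rintro _ ⟨b, hb, rfl⟩ x hx hfx
      induction x using OnePoint.rec with
      | infty => exact absurd rfl hx.2
      | coe z =>
        have : b = 0 := by simpa using hfx
        rw [this, aff_one])
    rw [card_tL, Set.ncard_sdiff_singleton_of_mem hinfO] at h
    obtain ⟨s, hs⟩ := h
    rw [← hqdef] at hs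
    have hpos : 0 < O.ncard := (Set.ncard_pos hOfin).2 ⟨_, hinfO⟩
    refine ⟨s, ?_, by omega⟩
    by_contra hlt
    have hs0 : s = 0 := by omega
    subst hs0
    have h1 : O.ncard = 1 := by omega
    obtain ⟨g, hg, hgi⟩ := hnf
    obtain ⟨x, hx⟩ := Set.ncard_eq_one.1 h1
    have e1 : (∞ : OnePoint K) = x := by rw [hx] at hinfO; exact hinfO
    have e2 : g • (∞ : OnePoint K) = x := by
      have := orbit_sub hg hinfO
      rw [← hO, hx] at this; exact this
    exact hgi (e2.trans e1.symm)
  have hG : (1 + q * s) * (q * n) = Nat.card G := by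
    rw [← hm, ← heinf]; exact orbit_mul_e G ∞
  -- counting
  have hcount : ∃ y, 2 ≤ e G y ∧ y ∉ O ∧ u G y = 1 ∧ n * (1 + q * s) = e G y * (1 + (q - 2) * s) ∧
      (∀ w, 2 ≤ e G w → w ∈ O ∨ w ∈ MulAction.orbit G y) := by
    obtain ⟨R, h2, hne, hR, hsum⟩ := count G
    have hqn : 2 ≤ q * n := hq.trans (Nat.le_mul_of_pos_right q hn)
    obtain ⟨x0, hx0, hx0i⟩ := hR ∞ (by rw [heinf]; exact hqn)
    have hOx : O = MulAction.orbit G x0 := MulAction.orbit_eq_iff.2 hx0i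
    rw [← Finset.add_sum_erase R _ hx0] at hsum
    rw [← e_orbit hx0i, ← u_orbit hx0i, heinf, huinf, ← hG] at hsum
    have hqQ : (2 : ℚ) ≤ q := by exact_mod_cast hq
    have hnQ : (1 : ℚ) ≤ n := by exact_mod_cast hn
    have hsQ : (1 : ℚ) ≤ s := by exact_mod_cast hs1
    have hgpos : (0 : ℚ) < 2 / (((1 + q * s) * (q * n) : ℕ) : ℚ) := by
      push_cast
      positivity
    have ht0 : (((q * n : ℕ) : ℚ) + q - 2) / ((q * n : ℕ) : ℚ) = 1 + ((q : ℚ) - 2) / (q * n) := by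
      push_cast
      field_simp
      ring
    have ht0' : 0 ≤ ((q : ℚ) - 2) / (q * n) := by
      apply div_nonneg
      · linarith
      · positivity
    rw [ht0] at hsum
    have hupos : ∀ x, (1 : ℚ) ≤ u G x := by
      intro x
      have : 1 ≤ u G x := by unfold u; omega
      exact_mod_cast this
    have hhalf : ∀ x ∈ R.erase x0, (1 / 2 : ℚ) ≤ ((e G x : ℚ) + u G x - 2) / e G x := by
      intro x hx
      have h3 := h2 x (Finset.mem_of_mem_erase hx)
      have h4 : (2 : ℚ) ≤ e G x := by exact_mod_cast h3
      rw [le_div_iff₀ (by linarith)]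
      have := hupos x
      linarith
    have hcard : (R.erase x0).card < 2 := by
      by_contra hlt
      have h3 := Finset.card_nsmul_le_sum _ _ _ hhalf
      rw [nsmul_eq_mul] at h3
      have h4 : (2 : ℚ) ≤ (R.erase x0).card := by
        have : 2 ≤ (R.erase x0).card := by omega
        exact_mod_cast this
      linarith
    have hcard1 : (R.erase x0).card ≠ 0 := by
      intro h
      rw [Finset.card_eq_zero.1 h, Finset.sum_empty] at hsum
      have h3 : ((q : ℚ) - 2) / (q * n) ≤ ((q : ℚ) - 2) / q := by
        apply div_le_div_of_nonneg_left
        · linarith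
        · linarith
        · nlinarith
      have h4 : 2 / (((1 + q * s) * (q * n) : ℕ) : ℚ) ≤ 2 / (3 * q) := by
        apply div_le_div_of_nonneg_left
        · norm_num
        · linarith
        · push_cast
          have a1 : (3 : ℚ) ≤ 1 + q * s := by nlinarith
          have a2 : (q : ℚ) ≤ q * n := by nlinarith
          exact mul_le_mul a1 a2 (by linarith) (by linarith)
      have h5 : ((q : ℚ) - 2) / q + 2 / (3 * q) < 1 := by
        rw [div_add_div _ _ (by linarith) (by linarith), div_lt_one (by positivity)]
        nlinarith
      linarith
    obtain ⟨y, hy⟩ := Finset.card_eq_one.1 (by omega : (R.erase x0).card = 1)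
    rw [hy, Finset.sum_singleton] at hsum
    have hyR : y ∈ R.erase x0 := by rw [hy]; simp
    have hyR' := Finset.mem_of_mem_erase hyR
    have hyx : y ≠ x0 := Finset.ne_of_mem_erase hyR
    have hey := h2 y hyR'
    have heyQ : (2 : ℚ) ≤ e G y := by exact_mod_cast hey
    have huy : u G y = 1 := by
      by_contra hne1
      have h3 : 2 ≤ u G y := by
        have : 1 ≤ u G y := by unfold u; omega
        omega
      have h4 : (2 : ℚ) ≤ u G y := by exact_mod_cast h3
      have h5 : (1 : ℚ) ≤ ((e G y : ℚ) + u G y - 2) / e G y := by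
        rw [le_div_iff₀ (by linarith)]; linarith
      linarith
    refine ⟨y, hey, ?_, huy, ?_, ?_⟩
    · intro hyO
      rw [hOx] at hyO
      exact hyx (hne y hyR' x0 hx0 hyO)
    · rw [huy] at hsum
      have hq0 : (q : ℚ) ≠ 0 := by positivity
      have hn0 : (n : ℚ) ≠ 0 := by positivity
      have he0 : (e G y : ℚ) ≠ 0 := by positivity
      have hm0 : (1 + (q : ℚ) * s) ≠ 0 := by positivity
      have : (n : ℚ) * (1 + q * s) = e G y * (1 + (q - 2) * s) := by
        push_cast at hsum
        field_simp at hsum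
        have h8 : (q : ℚ) * ((n : ℚ) * (1 + q * s)) = q * (e G y * (1 + (q - 2) * s)) := by
          linear_combination (-1 : ℚ) * hsum
        exact mul_left_cancel₀ hq0 h8
      have h9 : ((q - 2 : ℕ) : ℚ) = (q : ℚ) - 2 := by
        rw [Nat.cast_sub hq]; norm_num
      rw [← h9] at this
      exact_mod_cast this
    · intro w hw
      obtain ⟨v, hv, hwv⟩ := hR w hw
      by_cases hvx : v = x0
      · left; rw [hOx, ← hvx]; exact hwv
      · right
        have : v ∈ R.erase x0 := Finset.mem_erase.2 ⟨hvx, hv⟩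
        rw [hy, Finset.mem_singleton] at this
        rw [← this]; exact hwv
  obtain ⟨y, hey, hyO, huy, hmain, hcov⟩ := hcount
  have h0O : ((0 : K) : OnePoint K) ∈ O := by
    by_cases hD : tD G = ⊥
    · exact h0 hD
    obtain ⟨a, ha, ha1⟩ := (Subgroup.ne_bot_iff_exists_ne_one.1 hD |>.imp
      (fun a ha => (⟨a.2, fun h => ha (Subtype.ext h)⟩ : a.1 ∈ tD G ∧ a.1 ≠ 1)) :
        ∃ a : tD G, a.1 ∈ tD G ∧ a.1 ≠ 1)
    set d := aff a.1 0 with hd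
    have hd1 : d ≠ 1 := by
      intro h
      rw [hd, ← aff_one] at h
      exact ha1 (aff_inj.1 h).1
    have hd0 : d • ((0 : K) : OnePoint K) = ((0 : K) : OnePoint K) := by
      rw [hd, aff_coe]; simp
    have hdi : d • (∞ : OnePoint K) = ∞ := aff_inf _ _
    by_contra hno
    have hy0 : ((0 : K) : OnePoint K) ∈ MulAction.orbit G y :=
      (hcov _ (two_le_e.2 ⟨d, ha, hd1, hd0⟩)).resolve_left hno
    have hfix : ∀ h ∈ st G ((0 : K) : OnePoint K), h • (∞ : OnePoint K) = ∞ := by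
      intro h hh
      have hcomm : d * h = h * d := by
        have hk0 : (d * h * d⁻¹ * h⁻¹) • ((0 : K) : OnePoint K) = ((0 : K) : OnePoint K) := by
          have e1 : d⁻¹ • ((0 : K) : OnePoint K) = ((0 : K) : OnePoint K) :=
            inv_smul_eq_iff.2 hd0.symm
          have e2 : h⁻¹ • ((0 : K) : OnePoint K) = ((0 : K) : OnePoint K) :=
            inv_smul_eq_iff.2 hh.2.symm
          rw [mul_smul, e2, mul_smul, e1, mul_smul, show h • ((0 : K) : OnePoint K) = _ from hh.2,
            hd0]
        by_cases hk : d * h * d⁻¹ * h⁻¹ = 1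
        · have := mul_inv_eq_one.1 hk
          exact mul_inv_eq_iff_eq_mul.1 this
        have hU : U G ((0 : K) : OnePoint K) = ∅ := by
          rw [← u_eq_one, u_orbit hy0, huy]
        have hkG : d * h * d⁻¹ * h⁻¹ ∈ G :=
          G.mul_mem (G.mul_mem (G.mul_mem ha hh.1) (G.inv_mem ha)) (G.inv_mem hh.1)
        have hnU : d * h * d⁻¹ * h⁻¹ ∉ U G ((0 : K) : OnePoint K) := by rw [hU]; simp
        have : ∃ z, (d * h * d⁻¹ * h⁻¹) • z = z ∧ ((0 : K) : OnePoint K) ≠ z := by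
          by_contra hcon
          push Not at hcon
          exact hnU ⟨hkG, hk, fun z => ⟨fun hz => (hcon z hz).symm, fun hz => hz ▸ hk0⟩⟩
        obtain ⟨z, hz1, hz2⟩ := this
        exact comm_fix hd0 hh.2 hz1 hz2
      have h3 : d • (h • (∞ : OnePoint K)) = h • (∞ : OnePoint K) := by
        rw [← mul_smul, hcomm, mul_smul, hdi]
      by_contra hne
      have hne0 : h • (∞ : OnePoint K) ≠ ((0 : K) : OnePoint K) := by
        intro h5
        have h6 : h • (∞ : OnePoint K) = h • ((0 : K) : OnePoint K) := h5.trans hh.2.symm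
        exact OnePoint.infty_ne_coe _ (MulAction.injective h h6)
      exact hd1 (fix3 (OnePoint.infty_ne_coe (0 : K)) (Ne.symm hne) hne0.symm hdi hd0 h3)
    have hle : e G ((0 : K) : OnePoint K) ≤ n := by
      have key : ∀ h : st G ((0 : K) : OnePoint K), ∃ a : tD G, h.1 = aff a.1 0 := by
        intro h
        obtain ⟨a, b, hab⟩ := exists_aff (hfix h.1 h.2)
        have h3 : h.1 • ((0 : K) : OnePoint K) = ((0 : K) : OnePoint K) := h.2.2
        rw [hab, aff_coe] at h3
        have hb : b = 0 := by simpa using h3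
        subst hb
        exact ⟨⟨a, by rw [mem_tD, ← hab]; exact h.2.1⟩, hab⟩
      choose f hf using key
      refine Nat.card_le_card_of_injective f ?_
      intro g h hgh
      apply Subtype.ext
      rw [hf, hf, hgh]
    rw [e_orbit hy0] at hle
    have h5 : e G y * (1 + (q - 2) * s) ≤ n * (1 + (q - 2) * s) := Nat.mul_le_mul_right _ hle
    rw [← hmain] at h5
    have h6 := Nat.le_of_mul_le_mul_left h5 hn
    have h7 : (q - 2) * s < q * s := Nat.mul_lt_mul_of_pos_right (by omega) hs1
    omega
  have hAO : ∀ b ∈ tA G, (b : OnePoint K) ∈ O := by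
    intro b hb
    have := orbit_sub (x := (∞ : OnePoint K)) (g := aff 1 b) hb h0O
    rw [aff_coe] at this
    simpa using this
  refine ⟨y, s, hs1, hm, hmain, ?_, hcov, hAO⟩
  set AI : Set (OnePoint K) := (fun b : K => (b : OnePoint K)) '' (tA G : Set K) with hAI
  have hS := free_dvd (st G ∞) (O \ (insert (∞ : OnePoint K) AI)) (by
    intro g hg x hx
    obtain ⟨a, ha, b, hb, rfl⟩ := st_inf hN hg
    refine ⟨orbit_sub hg.1 hx.1, ?_⟩
    induction x using OnePoint.rec with
    | infty => exact absurd (Set.mem_insert _ _) hx.2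
    | coe z =>
      rw [aff_coe]
      rintro (h | ⟨c, hc, h⟩)
      · exact OnePoint.coe_ne_infty _ h
      · apply hx.2
        right
        have h' : c = a * z + b := by simpa using h
        refine ⟨z, ?_, rfl⟩
        have : z = ((a⁻¹ : Kˣ) : K) * (c - b) := by rw [h']; simp
        rw [this]
        exact tD_mul_tA ((tD G).inv_mem ha) ((tA G).sub_mem hc hb)) (by
    intro g hg x hx hfx
    obtain ⟨a, ha, b, hb, rfl⟩ := st_inf hN hg
    induction x using OnePoint.rec with
    | infty => exact absurd (Set.mem_insert _ _) hx.2
    | coe z =>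
      have hz : (a : K) * z + b = z := by simpa using hfx
      by_cases h1 : a = 1
      · subst h1
        have : b = 0 := by simpa using hz
        rw [this, aff_one]
      · exfalso
        obtain ⟨c, hc, hcb⟩ := one_sub_div ha h1 hb
        have h3 : (1 - (a : K)) * (c - z) = 0 := by linear_combination hcb + hz
        rcases mul_eq_zero.1 h3 with h | h
        · apply h1; apply Units.ext
          rw [sub_eq_zero] at h; exact h.symm
        · apply hx.2
          right
          exact ⟨c, hc, by rw [sub_eq_zero.1 h]⟩)
  have hAIcard : AI.ncard = q := by
    rw [hAI, Set.ncard_image_of_injective _ OnePoint.coe_injective]; rfl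
  have hAIfin : AI.Finite := Set.Finite.image _ (inferInstanceAs (Finite (tA G)))
  have hIcard : (insert (∞ : OnePoint K) AI).ncard = q + 1 := by
    rw [Set.ncard_insert_of_notMem _ hAIfin, hAIcard]
    rintro ⟨c, _, h⟩
    exact OnePoint.coe_ne_infty _ h
  have hsub : insert (∞ : OnePoint K) AI ⊆ O := by
    rintro x (rfl | ⟨b, hb, rfl⟩)
    · exact hinfO
    · exact hAO b hb
  rw [Set.ncard_sdiff hsub (hAIfin.insert _), hIcard, hm] at hS
  change e G ∞ ∣ _ at hS
  rw [heinf] at hS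
  have : 1 + q * s - (q + 1) = q * (s - 1) := by
    rw [Nat.mul_sub, mul_one]; omega
  rw [this] at hS
  exact Nat.dvd_of_mul_dvd_mul_left (by omega) hS

end wild
end Dick

namespace Dick

open OnePoint

section fld

variable {F K : Type} [Field F] [Field K]

/-- functoriality of `PGL2` -/
noncomputable def pg (f : F →+* K) : PGL2 F →* PGL2 K :=
  QuotientGroup.map _ _ (Matrix.GeneralLinearGroup.map f) (by
    intro A hA
    rw [center_iff] at hA
    rw [Subgroup.mem_comap, center_iff]
    simp only [Matrix.GeneralLinearGroup.map_apply]
    simp [hA])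

lemma pg_mk (f : F →+* K) (A : GL (Fin 2) F) :
    pg f (A : PGL2 F) = ((Matrix.GeneralLinearGroup.map f A : GL (Fin 2) K) : PGL2 K) := rfl

lemma pg_injective (f : F →+* K) : Function.Injective (pg f) := by
  rw [injective_iff_map_eq_one]
  intro g hg
  induction g using QuotientGroup.induction_on with | H A =>
  rw [pg_mk, QuotientGroup.eq_one_iff, center_iff] at hg
  simp only [Matrix.GeneralLinearGroup.map_apply] at hg
  rw [QuotientGroup.eq_one_iff, center_iff]
  refine ⟨f.injective (by simpa using hg.1), f.injective (by simpa using hg.2.1),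
    f.injective hg.2.2⟩

lemma pg_aff (f : F →+* K) (b : F) : pg f (aff 1 b) = aff 1 (f b) := by
  rw [aff, pg_mk, aff]
  congr 1
  apply gl_ext <;> simp [Matrix.GeneralLinearGroup.map_apply]

lemma mk_mt (A : GL (Fin 2) F) : A = mt (A 0 0) (A 0 1) (A 1 0) (A 1 1) (det_ne A) := by
  apply gl_ext <;> simp

lemma sl_le (V : Subgroup (PGL2 F)) (h1 : ∀ b, aff 1 b ∈ V) (M : GL (Fin 2) F)
    (hM : (M : PGL2 F) ∈ V) (h0 : M 0 0 = 0) (N : GL (Fin 2) F)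
    (hN : N 0 0 * N 1 1 - N 0 1 * N 1 0 = 1) : (N : PGL2 F) ∈ V := by
  have hd := det_ne M
  rw [h0, zero_mul, zero_sub, neg_ne_zero] at hd
  have hβ : M 0 1 ≠ 0 := left_ne_zero_of_mul hd
  have hγ : M 1 0 ≠ 0 := right_ne_zero_of_mul hd
  have hL : ∀ c : F, ((mt 1 0 c 1 (by simp) : GL (Fin 2) F) : PGL2 F) ∈ V := by
    intro c
    have h2 := V.mul_mem (V.mul_mem hM (h1 (c * M 0 1 / M 1 0))) (V.inv_mem hM)
    convert h2 using 1
    rw [eq_mul_inv_iff_mul_eq, aff, ← QuotientGroup.mk_mul, ← QuotientGroup.mk_mul]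
    refine mk_eq _ _ 1 one_ne_zero ?_ ?_ ?_ ?_ <;> simp [Matrix.mul_apply, h0]
    field_simp
  have key : ∀ N : GL (Fin 2) F, N 0 0 * N 1 1 - N 0 1 * N 1 0 = 1 → N 1 0 ≠ 0 →
      (N : PGL2 F) ∈ V := by
    intro N hN hc
    have h2 := V.mul_mem (V.mul_mem (h1 ((N 0 0 - 1) / N 1 0)) (hL (N 1 0)))
      (h1 ((N 1 1 - 1) / N 1 0))
    convert h2 using 1
    rw [aff, aff, ← QuotientGroup.mk_mul, ← QuotientGroup.mk_mul]
    refine mk_eq _ _ 1 one_ne_zero ?_ ?_ ?_ ?_ <;> simp [Matrix.mul_apply]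
    · field_simp; ring
    · field_simp
      linear_combination -hN
    · field_simp; ring
  by_cases hc : N 1 0 = 0
  · have ha : N 0 0 ≠ 0 := by
      intro h
      simp [hc, h] at hN
    have h2 := key (mt 1 0 1 1 (by simp) * N) (by
      simp [Matrix.mul_apply]
      linear_combination hN) (by simpa [Matrix.mul_apply, hc] using ha)
    rw [QuotientGroup.mk_mul] at h2
    exact (V.mul_mem_cancel_left (hL 1)).1 h2
  · exact key N hN hc

/-- determinant -/
noncomputable def dt (M : GL (Fin 2) F) : F := M 0 0 * M 1 1 - M 0 1 * M 1 0

lemma dt_mul (M N : GL (Fin 2) F) : dt (M * N) = dt M * dt N := by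
  simp [dt, Matrix.mul_apply]; ring

lemma dt_ne (M : GL (Fin 2) F) : dt M ≠ 0 := det_ne M

lemma sq_scale (M : GL (Fin 2) F) (h : IsSquare (dt M)) :
    ∃ N : GL (Fin 2) F, dt N = 1 ∧ (M : PGL2 F) = N := by
  obtain ⟨r, hr⟩ := h
  have hd := dt_ne M
  have hr0 : r ≠ 0 := by rintro rfl; simp [hr] at hd
  have h1 : M 0 0 / r * (M 1 1 / r) - M 0 1 / r * (M 1 0 / r) = 1 := by
    rw [dt] at hr
    field_simp
    linear_combination hr
  refine ⟨mt (M 0 0 / r) (M 0 1 / r) (M 1 0 / r) (M 1 1 / r) (by rw [h1]; exact one_ne_zero), ?_, ?_⟩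
  · simpa [dt] using h1
  · refine mk_eq _ _ r hr0 ?_ ?_ ?_ ?_ <;> simp <;> field_simp

lemma nonsq_mul [Finite F] {a b : F} (ha : ¬ IsSquare a) (hb : ¬ IsSquare b) : IsSquare (a * b) := by
  classical
  haveI := Fintype.ofFinite F
  by_cases h2 : ringChar F = 2
  · exact FiniteField.isSquare_of_char_two h2 _
  have h0 : a * b ≠ 0 := by
    rintro h
    rcases mul_eq_zero.1 h with rfl | rfl <;> simp at ha hb
  rw [← quadraticChar_one_iff_isSquare h0, map_mul,
    quadraticChar_neg_one_iff_not_isSquare.2 ha, quadraticChar_neg_one_iff_not_isSquare.2 hb]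
  rfl

lemma dickson_fin [Finite F] (V : Subgroup (PGL2 F))
    (hV : ∀ N : GL (Fin 2) F, dt N = 1 → (N : PGL2 F) ∈ V) :
    Nonempty (V ≃* PSL2 F) ∨ Nonempty (V ≃* PGL2 F) := by
  have hsq : ∀ N : GL (Fin 2) F, IsSquare (dt N) → (N : PGL2 F) ∈ V := by
    intro N h
    obtain ⟨N', h1, h2⟩ := sq_scale N h
    rw [h2]; exact hV _ h1
  by_cases hall : ∀ M : GL (Fin 2) F, (M : PGL2 F) ∈ V → IsSquare (dt M)
  · left
    have hdet : ∀ s : Matrix.SpecialLinearGroup (Fin 2) F,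
        dt (Matrix.SpecialLinearGroup.toGL s) = 1 := by
      intro s
      have := s.2
      rw [Matrix.det_fin_two] at this
      exact this
    let φ : Matrix.SpecialLinearGroup (Fin 2) F →* V :=
      MonoidHom.codRestrict ((QuotientGroup.mk' (Subgroup.center (GL (Fin 2) F))).comp
        Matrix.SpecialLinearGroup.toGL) V (fun s => hV _ (hdet s))
    have hk : φ.ker = Subgroup.center _ := by
      ext s
      rw [MonoidHom.mem_ker, ← Matrix.SpecialLinearGroup.toGL_mem_center_iff,
        ← QuotientGroup.eq_one_iff]
      exact Subtype.ext_iff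
    have hs : Function.Surjective φ := by
      rintro ⟨g, hg⟩
      induction g using QuotientGroup.induction_on with | H A =>
      obtain ⟨N, h1, h2⟩ := sq_scale A (hall A hg)
      refine ⟨⟨N.1, by rw [Matrix.det_fin_two]; exact h1⟩, Subtype.ext ?_⟩
      refine Eq.trans ?_ h2.symm
      change ((_ : GL (Fin 2) F) : PGL2 F) = _
      congr 1
      apply Units.ext
      rfl
    exact ⟨((QuotientGroup.quotientMulEquivOfEq hk).symm.trans
      (QuotientGroup.quotientKerEquivOfSurjective φ hs)).symm⟩
  · right
    push Not at hall
    obtain ⟨M, hM, hns⟩ := hall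
    have : V = ⊤ := by
      rw [eq_top_iff]
      rintro g -
      induction g using QuotientGroup.induction_on with | H A =>
      by_cases hA : IsSquare (dt A)
      · exact hsq A hA
      · refine (V.mul_mem_cancel_left hM).1 ?_
        rw [← QuotientGroup.mk_mul]
        apply hsq
        rw [dt_mul]
        exact nonsq_mul hns hA
    subst this
    exact ⟨Subgroup.topEquiv⟩

end fld

end Dick

namespace Dick

open OnePoint

section psl

variable {K : Type} [Field K]

lemma mul_closed (G : Subgroup (PGL2 K)) [Finite G] (h1A : 1 ∈ tA G)
    (hn : Nat.card (tA G) - 1 ≤ 2 * Nat.card (tD G)) :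
    ∀ a ∈ tA G, ∀ b ∈ tA G, a * b ∈ tA G := by
  classical
  let R : AddSubgroup K :=
    { carrier := {c | ∀ b ∈ tA G, c * b ∈ tA G}
      zero_mem' := by intro b hb; rw [zero_mul]; exact (tA G).zero_mem
      add_mem' := by
        intro c d hc hd b hb
        rw [add_mul]
        exact (tA G).add_mem (hc b hb) (hd b hb)
      neg_mem' := by
        intro c hc b hb
        rw [neg_mul]
        exact (tA G).neg_mem (hc b hb) }
  have hR : R ≤ tA G := by
    intro c hc
    have := hc 1 h1A
    rwa [mul_one] at this
  have hdvd : Nat.card R ∣ Nat.card (tA G) := AddSubgroup.card_dvd_of_le hR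
  have : Finite R := Finite.of_injective _ (AddSubgroup.inclusion_injective hR)
  have hge : Nat.card (tD G) + 1 ≤ Nat.card R := by
    have h2 : Nat.card (Option (tD G)) = Nat.card (tD G) + 1 := Finite.card_option
    rw [← h2]
    let f : Option (tD G) → R := fun o => match o with
      | Option.none => 0
      | Option.some a => ⟨(a.1 : K), fun b hb => tD_mul_tA a.2 hb⟩
    refine Nat.card_le_card_of_injective f ?_
    rintro (_ | a) (_ | b) h
    · rfl
    · exact absurd (congrArg Subtype.val h).symm b.1.ne_zero
    · exact absurd (congrArg Subtype.val h) a.1.ne_zero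
    · have h3 : (a.1 : K) = b.1 := congrArg Subtype.val h
      rw [Subtype.ext (Units.ext h3)]
  have hq : 0 < Nat.card (tA G) := Nat.card_pos
  have heq : Nat.card R = Nat.card (tA G) := by
    obtain ⟨m, hm⟩ := hdvd
    rcases m with _ | _ | m
    · omega
    · omega
    · exfalso
      have : Nat.card R * 2 ≤ Nat.card R * (m + 1 + 1) := Nat.mul_le_mul_left _ (by omega)
      omega
  have hRA : R = tA G := AddSubgroup.eq_of_le_of_card_ge hR heq.ge
  intro a ha
  rw [← hRA] at ha
  exact ha

lemma psl_field (p : ℕ) [Fact p.Prime] [CharP K p] (G : Subgroup (PGL2 K)) [Finite G]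
    (h1A : 1 ∈ tA G) (hmul : ∀ a ∈ tA G, ∀ b ∈ tA G, a * b ∈ tA G) :
    ∃ t, 1 ≤ t ∧ ∃ ι : GaloisField p t →+* K, ∀ z, z ∈ tA G ↔ ∃ w, ι w = z := by
  let S : Subring K :=
    { tA G with
      one_mem' := h1A
      mul_mem' := fun {a b} ha hb => hmul a ha b hb }
  have hS : ∀ z, z ∈ S ↔ z ∈ tA G := fun z => Iff.rfl
  have : Finite S := inferInstanceAs (Finite (tA G))
  let : Field S := (Finite.isField_of_domain S).toField
  have : CharP S p := (S.subtype.charP_iff S.subtype_injective p).2 inferInstance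
  obtain ⟨t, ht, -⟩ := elem_ab p (tA G)
  let : Algebra (ZMod p) S := ZMod.algebra S p
  have hc : Nat.card S = p ^ t := ht
  have hnt : 1 < Nat.card S := Finite.one_lt_card
  have ht1 : 1 ≤ t := by
    by_contra h
    have : t = 0 := by omega
    rw [hc, this] at hnt
    simp at hnt
  let φ := GaloisField.algEquivGaloisField p t hc
  refine ⟨t, ht1, S.subtype.comp (φ.symm : GaloisField p t →+* S), ?_⟩
  intro z
  constructor
  · intro hz
    refine ⟨φ ⟨z, hz⟩, ?_⟩
    simp
  · rintro ⟨w, rfl⟩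
    exact (φ.symm w).2

lemma psl_case (p : ℕ) [Fact p.Prime] [CharP K p] (G : Subgroup (PGL2 K)) [Finite G]
    (h1A : 1 ∈ tA G) (hO : ∀ z : K, (z : OnePoint K) ∈ MulAction.orbit G (∞ : OnePoint K) ↔ z ∈ tA G)
    (hn : Nat.card (tA G) - 1 ≤ 2 * Nat.card (tD G)) : Concl p G := by
  have hmul := mul_closed G h1A hn
  obtain ⟨t, ht, ι, hι⟩ := psl_field p G h1A hmul
  have hinf : (∞ : OnePoint K) ∈ MulAction.orbit G (∞ : OnePoint K) := MulAction.mem_orbit_self _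
  have hrange : ∀ g ∈ G, ∃ M : GL (Fin 2) (GaloisField p t), pg ι (M : PGL2 _) = g := by
    intro g hg
    have hz : ∀ z w : K, z ∈ tA G → g • (z : OnePoint K) = (w : OnePoint K) → w ∈ tA G := by
      intro z w h1 h2
      rw [← hO, ← h2]
      exact orbit_sub hg ((hO z).2 h1)
    have hi : ∀ w : K, g • (∞ : OnePoint K) = (w : OnePoint K) → w ∈ tA G := by
      intro w h2
      rw [← hO, ← h2]
      exact orbit_sub hg hinf
    have hi' : ∀ w : K, g • (w : OnePoint K) = ∞ → w ∈ tA G := by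
      intro w h2
      rw [← hO]
      have h3 := orbit_sub (G.inv_mem hg) hinf
      have h4 : g⁻¹ • (∞ : OnePoint K) = w := by rw [← h2, inv_smul_smul]
      rwa [h4] at h3
    clear hg
    induction g using QuotientGroup.induction_on with | H A =>
    have hd := det_ne A
    by_cases h10 : A 1 0 = 0
    · rw [h10, mul_zero, sub_zero] at hd
      have h00 := left_ne_zero_of_mul hd
      have h11 := right_ne_zero_of_mul hd
      have k0 := hz 0 _ (tA G).zero_mem (smul_coe1 A 0 (by simpa using h11))
      have k1 := hz 1 _ h1A (smul_coe1 A 1 (by simpa [h10] using h11))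
      simp only [h10, mul_zero, zero_add, zero_mul, mul_one] at k0 k1
      have k2 := (tA G).sub_mem k1 k0
      have k3 : A 0 0 / A 1 1 ∈ tA G := by
        convert k2 using 1
        field_simp; ring
      obtain ⟨w1, e1⟩ := (hι _).1 k3
      obtain ⟨w2, e2⟩ := (hι _).1 k0
      have hw1 : w1 ≠ 0 := by
        rintro rfl
        rw [map_zero] at e1
        exact div_ne_zero h00 h11 e1.symm
      refine ⟨mt w1 w2 0 1 (by simpa using hw1), ?_⟩
      rw [pg_mk]
      symm
      refine mk_eq _ _ (A 1 1) h11 ?_ ?_ ?_ ?_ <;>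
        simp [Matrix.GeneralLinearGroup.map_apply, e1, e2, h10] <;> field_simp
    · have ka := hi _ (smul_inf1 A h10)
      have kd := (tA G).neg_mem (hi' (-(A 1 1 / A 1 0)) (smul_coe0 A _ (by field_simp; ring)))
      rw [neg_neg] at kd
      have kb : A 0 1 / A 1 0 ∈ tA G := by
        by_cases h11 : A 1 1 = 0
        · have k1 := hz 1 _ h1A (smul_coe1 A 1 (by simpa [h11] using h10))
          simp only [h11, add_zero, mul_one] at k1
          convert (tA G).sub_mem k1 ka using 1
          field_simp; ring
        · have k1 := hz 0 _ (tA G).zero_mem (smul_coe1 A 0 (by simpa using h11))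
          simp only [mul_zero, zero_add] at k1
          convert hmul _ k1 _ kd using 1
          field_simp
      obtain ⟨w1, e1⟩ := (hι _).1 ka
      obtain ⟨w2, e2⟩ := (hι _).1 kb
      obtain ⟨w3, e3⟩ := (hι _).1 kd
      have hw : w1 * w3 - w2 * 1 ≠ 0 := by
        intro h
        have h' := congrArg ι h
        simp only [map_sub, map_mul, map_one, map_zero, e1, e2, e3] at h'
        apply hd
        field_simp at h'
        linear_combination h'
      refine ⟨mt w1 w2 1 w3 hw, ?_⟩
      rw [pg_mk]
      symm
      refine mk_eq _ _ (A 1 0) h10 ?_ ?_ ?_ ?_ <;>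
        simp [Matrix.GeneralLinearGroup.map_apply, e1, e2, e3] <;> field_simp
  let V := G.comap (pg ι)
  have hV1 : ∀ b, aff 1 b ∈ V := by
    intro b
    rw [Subgroup.mem_comap, pg_aff, ← mem_tA, hι]
    exact ⟨b, rfl⟩
  obtain ⟨⟨g, hg⟩, hg0⟩ := (hO 0).2 (tA G).zero_mem
  obtain ⟨M, hM⟩ := hrange g hg
  have hMV : (M : PGL2 _) ∈ V := by
    rw [Subgroup.mem_comap, hM]; exact hg
  have hM0 : M 0 0 = 0 := by
    have h1 : g • (∞ : OnePoint K) = ((0 : K) : OnePoint K) := hg0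
    rw [← hM, pg_mk] at h1
    by_cases h10 : M 1 0 = 0
    · rw [smul_inf0 _ (by simp [Matrix.GeneralLinearGroup.map_apply, h10])] at h1
      exact absurd h1.symm (OnePoint.coe_ne_infty _)
    · rw [smul_inf1 _ (by simpa [Matrix.GeneralLinearGroup.map_apply] using h10)] at h1
      rw [OnePoint.coe_eq_coe] at h1
      simpa [Matrix.GeneralLinearGroup.map_apply, h10] using h1
  have hsl := sl_le V hV1 M hMV hM0
  haveI : Finite (GaloisField p t) := inferInstance
  let ψ : V →* G := ((pg ι).comp V.subtype).codRestrict G (fun v => v.2)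
  have hψ : Function.Bijective ψ := by
    constructor
    · intro v w h
      exact Subtype.ext (pg_injective ι (congrArg Subtype.val h))
    · rintro ⟨g, hg⟩
      obtain ⟨M, hM⟩ := hrange g hg
      have hMV : (M : PGL2 _) ∈ V := by rw [Subgroup.mem_comap, hM]; exact hg
      refine ⟨⟨_, hMV⟩, ?_⟩
      apply Subtype.ext
      exact hM
  let ε : G ≃* V := (MulEquiv.ofBijective ψ hψ).symm
  rcases dickson_fin V hsl with ⟨⟨f⟩⟩ | ⟨⟨f⟩⟩
  · exact Or.inr (Or.inr (Or.inr (Or.inr (Or.inr (Or.inr (Or.inl ⟨t, ht, ⟨ε.trans f⟩⟩))))))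
  · exact Or.inr (Or.inr (Or.inr (Or.inr (Or.inr (Or.inr (Or.inr ⟨t, ht, ⟨ε.trans f⟩⟩))))))

end psl

end Dick

namespace Dick

open OnePoint

section wild

variable {K : Type} [Field K]

lemma wild_a5 [IsAlgClosed K] (G : Subgroup (PGL2 K)) [Finite G]
    (hN : ∀ a b, aff a b ∈ G → aff a 0 ∈ G) (hq : Nat.card (tA G) = 3) (hn : Nat.card (tD G) = 2)
    (hc : (MulAction.orbit G (∞ : OnePoint K)).ncard = 10) (y : OnePoint K) (he : e G y = 5)
    (hall : ∀ w, 2 ≤ e G w → w ∈ MulAction.orbit G (∞ : OnePoint K) ∨ w ∈ MulAction.orbit G y) :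
    Nonempty (G ≃* alternatingGroup (Fin 5)) := by
  have hG : Nat.card G = 60 := by
    rw [← orbit_mul_e G ∞, hc, e_inf hN, hq, hn]
  obtain ⟨a, haD, ha1, ha2, hau⟩ := card2 (tD G) hn
  have ha1' : (a : K) - 1 ≠ 0 := by
    intro h
    exact ha1 (Units.ext (sub_eq_zero.1 h))
  refine a5' G hG (aff a 0) haD ?_ ?_ ∞ ((0 : K) : OnePoint K) (OnePoint.coe_ne_infty _).symm
    ?_ ?_ ?_
  · rw [← aff_one, Ne, aff_inj]
    tauto
  · rw [aff_mul, ha2, ← aff_one]; simp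
  · intro z
    induction z using OnePoint.rec with
    | infty => simp
    | coe z =>
      rw [aff_coe, OnePoint.coe_eq_coe, OnePoint.coe_eq_coe]
      constructor
      · intro h
        right
        have : ((a : K) - 1) * z = 0 := by linear_combination h
        exact (mul_eq_zero.1 this).resolve_left ha1'
      · rintro (h | rfl)
        · exact absurd h (OnePoint.coe_ne_infty _)
        · simp
  · intro g hg h1 h2
    obtain ⟨a', b, rfl⟩ := exists_aff h1
    rw [aff_coe, OnePoint.coe_eq_coe] at h2
    have hb : b = 0 := by simpa using h2
    subst hb
    rcases hau a' hg with rfl | rfl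
    · left; exact aff_one
    · right; rfl
  · intro t ht h1 h2
    obtain ⟨w, hw⟩ := exists_fix t
    have ho : orderOf t = 2 := orderOf_eq_prime (by rw [pow_two, h2]) h1
    have hd := order_dvd_e ht hw
    rw [ho] at hd
    have hwO : w ∈ MulAction.orbit G (∞ : OnePoint K) := by
      rcases hall w (two_le_e.2 ⟨t, ht, h1, hw⟩) with h | h
      · exact h
      · rw [e_orbit h, he] at hd
        omega
    obtain ⟨⟨g, hg⟩, rfl⟩ := hwO
    have hw' : t • (g • (∞ : OnePoint K)) = g • (∞ : OnePoint K) := hw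
    have hst : g⁻¹ * t * g ∈ st G ∞ := by
      refine mem_st.2 ⟨G.mul_mem (G.mul_mem (G.inv_mem hg) ht) hg, ?_⟩
      rw [mul_smul, mul_smul, hw', inv_smul_smul]
    obtain ⟨a', ha', b, hb, hEq⟩ := st_inf hN hst
    have htt : t = g * aff a' b * g⁻¹ := by rw [← hEq]; group
    have hsq : aff a' b * aff a' b = 1 := by
      rw [← hEq]
      have : g⁻¹ * t * g * (g⁻¹ * t * g) = g⁻¹ * (t * t) * g := by group
      rw [this, h2]; group
    rcases hau a' ha' with rfl | rfl
    · exfalso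
      rw [aff_mul, ← aff_one, aff_inj] at hsq
      have h3 : (Nat.card (tA G)) • (⟨b, hb⟩ : tA G) = 0 := card_nsmul_eq_zero'
      rw [hq] at h3
      have h3' : (3 : ℕ) • b = 0 := congrArg Subtype.val h3
      have h4 : b + b = 0 := by simpa using hsq.2
      have hb0 : b = 0 := by
        have : (3 : ℕ) • b = b + (b + b) := by simp; ring
        rw [this, h4, add_zero] at h3'
        exact h3'
      apply h1
      rw [htt, hb0, aff_one]; group
    · obtain ⟨c, hc, hcb⟩ := one_sub_div haD ha1 hb
      refine ⟨g * aff 1 c, G.mul_mem hg hc, ?_⟩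
      have : aff a' b = aff 1 c * aff a' 0 * (aff 1 c)⁻¹ := by
        rw [aff_inv, aff_mul, aff_mul, aff_inj]
        refine ⟨by simp, ?_⟩
        simp
        linear_combination -hcb
      rw [htt, this]; group

lemma wild_norm [IsAlgClosed K] (p : ℕ) [Fact p.Prime] [CharP K p] (G : Subgroup (PGL2 K)) [Finite G]
    (h1A : (1 : K) ∈ tA G)
    (hN : ∀ a b, aff a b ∈ G → aff a 0 ∈ G) (hnf : ∃ g ∈ G, g • (∞ : OnePoint K) ≠ ∞)
    (h0 : tD G = ⊥ → ((0 : K) : OnePoint K) ∈ MulAction.orbit G (∞ : OnePoint K)) : Concl p G := by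
  obtain ⟨y, s, hs, hcard, heq, hdvd, hall, hsub⟩ := wild_count G h1A hN hnf h0
  have hq2 : 2 ≤ Nat.card (tA G) := by
    have : Nontrivial (tA G) := ⟨0, ⟨1, h1A⟩, by
      intro h
      exact zero_ne_one (congrArg Subtype.val h)⟩
    exact Finite.one_lt_card
  rcases wild_arith _ _ s (e G y) hq2 Nat.card_pos hs (card_tD_dvd G) hdvd heq with
    ⟨hq, hn, he⟩ | ⟨hs1, hle⟩ | ⟨hq, hn, hs3, he⟩
  · have hG := orbit_mul_e G (∞ : OnePoint K)
    rw [e_inf hN, hcard, hq, hn] at hG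
    have hG2 := orbit_mul_e G y
    rw [← hG, he] at hG2
    have h2 : (MulAction.orbit G y).ncard = 2 := by
      have h3 : (MulAction.orbit G y).ncard * (1 + 2 * s) = 2 * (1 + 2 * s) := by
        rw [hG2]; ring
      exact Nat.eq_of_mul_eq_mul_right (by omega) h3
    obtain ⟨t, ht, -⟩ := elem_ab p (tA G)
    rw [hq] at ht
    have hp2 : p = 2 := by
      have hp := (Fact.out : p.Prime)
      have ht0 : t ≠ 0 := by rintro rfl; simp at ht
      have : p ∣ 2 := by rw [ht]; exact dvd_pow_self p ht0
      exact (Nat.prime_dvd_prime_iff_eq hp Nat.prime_two).1 this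
    refine Or.inr (Or.inl ⟨e G y, ?_, dih G y h2⟩)
    rw [hp2, he]; omega
  · refine psl_case p G h1A ?_ hle
    have hfin : (MulAction.orbit G (∞ : OnePoint K)).Finite :=
      Set.finite_range _
    have hS : insert (∞ : OnePoint K) ((fun z : K => (z : OnePoint K)) '' (tA G : Set K)) =
        MulAction.orbit G (∞ : OnePoint K) := by
      refine Set.eq_of_subset_of_ncard_le ?_ ?_ hfin
      · rintro w (rfl | ⟨b, hb, rfl⟩)
        · exact MulAction.mem_orbit_self _
        · exact hsub b hb
      · have hfA : (tA G : Set K).Finite :=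
          Set.finite_coe_iff.1 (inferInstance : Finite (tA G))
        rw [hcard, hs1, Set.ncard_insert_of_notMem (by
            rintro ⟨b, -, hb⟩
            exact OnePoint.coe_ne_infty b hb) (hfA.image _),
          Set.ncard_image_of_injective _ OnePoint.coe_injective]
        have : (tA G : Set K).ncard = Nat.card (tA G) := rfl
        omega
    intro z
    rw [← hS]
    constructor
    · rintro (h | ⟨b, hb, h⟩)
      · exact absurd h (OnePoint.coe_ne_infty z)
      · have := OnePoint.coe_injective h
        rw [← this]; exact hb
    · intro h
      exact Or.inr ⟨z, h, rfl⟩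
  · have := wild_a5 G hN hq hn (by rw [hcard, hq, hs3]) y he hall
    exact Or.inr (Or.inr (Or.inr (Or.inr (Or.inl this))))

lemma cj_scale (r : Kˣ) (a : Kˣ) (b : K) (G : Subgroup (PGL2 K)) :
    aff a b ∈ cj (aff r 0) G ↔ aff a ((r⁻¹ : Kˣ) * b) ∈ G := by
  rw [mem_cj, aff_inv, aff_mul, aff_mul]
  have h1 : r⁻¹ * a * r = a := by rw [mul_right_comm, inv_mul_cancel, one_mul]
  rw [h1]
  simp

lemma cj_nf {G : Subgroup (PGL2 K)} {b : PGL2 K} (hb : b • (∞ : OnePoint K) = ∞)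
    (hnf : ∃ g ∈ G, g • (∞ : OnePoint K) ≠ ∞) : ∃ g ∈ cj b G, g • (∞ : OnePoint K) ≠ ∞ := by
  obtain ⟨g, hg, h⟩ := hnf
  refine ⟨b * g * b⁻¹, conj_mem_cj hg, ?_⟩
  intro h'
  apply h
  rw [← conj_fix b g, hb]
  exact h'

lemma cj_orbit {G : Subgroup (PGL2 K)} {b : PGL2 K} {x y : OnePoint K}
    (h : y ∈ MulAction.orbit G x) : b • y ∈ MulAction.orbit (cj b G) (b • x) := by
  obtain ⟨⟨g, hg⟩, rfl⟩ := h
  exact ⟨⟨b * g * b⁻¹, conj_mem_cj hg⟩, conj_smul b g x⟩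

/-- second normalization -/
lemma wild2 [IsAlgClosed K] (p : ℕ) [Fact p.Prime] [CharP K p] (G : Subgroup (PGL2 K)) [Finite G]
    (hA : u G ∞ ≠ 1)
    (hN : ∀ a b, aff a b ∈ G → aff a 0 ∈ G) (hnf : ∃ g ∈ G, g • (∞ : OnePoint K) ≠ ∞)
    (h0 : tD G = ⊥ → ((0 : K) : OnePoint K) ∈ MulAction.orbit G (∞ : OnePoint K)) : Concl p G := by
  obtain ⟨b, hb, hb0⟩ : ∃ b ∈ tA G, b ≠ 0 := by
    by_contra hcon
    push Not at hcon
    apply hA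
    rw [u_inf]
    have : Subsingleton (tA G) := ⟨fun x y => Subtype.ext (by
      rw [hcon x.1 x.2, hcon y.1 y.2])⟩
    exact Nat.card_unique
  let r : Kˣ := (Units.mk0 b hb0)⁻¹
  have hr : ((r⁻¹ : Kˣ) : K) = b := by simp [r]
  refine (wild_norm p (cj (aff r 0) G) ?_ ?_ (cj_nf (aff_inf _ _) hnf) ?_).congr (cjEquiv (aff r 0) G)
  · rw [mem_tA, cj_scale, hr, mul_one]; exact hb
  · intro a c h
    rw [cj_scale] at h ⊢
    rw [mul_zero]
    exact hN _ _ h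
  · intro hD
    have hD' : tD G = ⊥ := by
      rw [← hD]
      ext a
      rw [mem_tD, mem_tD, cj_scale, mul_zero]
    have := cj_orbit (b := aff r 0) (h0 hD')
    simpa using this

/-- first normalization -/
lemma wild1 [IsAlgClosed K] (p : ℕ) [Fact p.Prime] [CharP K p] (G : Subgroup (PGL2 K)) [Finite G]
    (hA : u G ∞ ≠ 1) (hnf : ∃ g ∈ G, g • (∞ : OnePoint K) ≠ ∞) : Concl p G := by
  have hu : ∀ v : K, u (cj (aff 1 v) G) ∞ ≠ 1 := by
    intro v
    have := u_cj (aff 1 v) G ∞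
    rw [aff_inf] at this
    rwa [this]
  by_cases hD : ∀ a b, aff a b ∈ G → a = 1
  · obtain ⟨g, hg, hgi⟩ := hnf
    obtain ⟨z, hz⟩ : ∃ z : K, g • (∞ : OnePoint K) = (z : OnePoint K) := by
      obtain ⟨z, hz⟩ := OnePoint.ne_infty_iff_exists.1 hgi
      exact ⟨z, hz.symm⟩
    refine (wild2 p (cj (aff 1 (-z)) G) (hu _) ?_ (cj_nf (aff_inf _ _) ⟨g, hg, hgi⟩) ?_).congr
      (cjEquiv _ G)
    · intro a b h
      rw [cj_trans] at h
      rw [hD _ _ h, aff_one]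
      exact Subgroup.one_mem _
    · intro _
      have h1 : (z : OnePoint K) ∈ MulAction.orbit G (∞ : OnePoint K) := ⟨⟨g, hg⟩, hz⟩
      have := cj_orbit (b := aff 1 (-z)) h1
      simpa using this
  · push Not at hD
    obtain ⟨a, b, hab, ha⟩ := hD
    obtain ⟨v, hv⟩ := norm0 G
    refine (wild2 p (cj (aff 1 v) G) (hu _) hv (cj_nf (aff_inf _ _) hnf) ?_).congr
      (cjEquiv _ G)
    intro h
    exfalso
    have h1 : aff a (b + v - a * v) ∈ cj (aff 1 v) G := by
      rw [cj_trans]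
      convert hab using 2
      ring
    have h2 : a ∈ tD (cj (aff 1 v) G) := hv _ _ h1
    rw [h] at h2
    exact ha h2

lemma main [IsAlgClosed K] (p : ℕ) [Fact p.Prime] [CharP K p] (G : Subgroup (PGL2 K)) [Finite G] :
    Concl p G := by
  by_cases hT : ∀ x, u G x = 1
  · exact tame p G hT
  push Not at hT
  obtain ⟨x, hx⟩ := hT
  obtain ⟨b, hb⟩ := exists_to_inf x
  refine Concl.congr (cjEquiv b G) ?_
  by_cases hfix : ∀ g ∈ cj b G, g • (∞ : OnePoint K) = ∞
  · exact borel p _ ∞ hfix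
  · push Not at hfix
    refine wild1 p _ ?_ hfix
    rw [← hb, u_cj]; exact hx

end wild

end Dick

theorem finite_subgroup_PGL2_charP_classification
    (k : Type) [Field k] (p : ℕ) [hp : Fact p.Prime] [CharP k p]
    (H : Subgroup (PGL2 k)) [Finite H] :
    (∃ n : ℕ, ¬ p ∣ n ∧ Nonempty (H ≃* Multiplicative (ZMod n))) ∨
    (∃ n : ℕ, ¬ p ∣ n ∧ Nonempty (H ≃* DihedralGroup n)) ∨
    Nonempty (H ≃* alternatingGroup (Fin 4)) ∨
    Nonempty (H ≃* Equiv.Perm (Fin 4)) ∨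
    Nonempty (H ≃* alternatingGroup (Fin 5)) ∨
    (∃ (t n : ℕ) (_ : n ∣ p ^ t - 1)
      (φ : Multiplicative (ZMod n) →* MulAut (Multiplicative (Fin t → ZMod p))),
      (∀ c : Multiplicative (ZMod n), c ≠ 1 →
        ∀ e : Multiplicative (Fin t → ZMod p), φ c e = e → e = 1) ∧
      Nonempty (H ≃* (Multiplicative (Fin t → ZMod p)) ⋊[φ] Multiplicative (ZMod n))) ∨
    (∃ t : ℕ, 1 ≤ t ∧ Nonempty (H ≃* PSL2 (GaloisField p t))) ∨
    (∃ t : ℕ, 1 ≤ t ∧ Nonempty (H ≃* PGL2 (GaloisField p t))) := by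
  have : CharP (AlgebraicClosure k) p :=
    charP_of_injective_algebraMap (algebraMap k (AlgebraicClosure k)).injective p
  let f := Dick.pg (algebraMap k (AlgebraicClosure k))
  let ε : H ≃* H.map f := H.equivMapOfInjective f (Dick.pg_injective _)
  have : Finite (H.map f) := Finite.of_equiv _ ε.toEquiv
  exact Dick.Concl.congr ε (Dick.main p (H.map f))
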